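/- arXiv:math/0210131 — 6 statements merged into one kernel-verified Lean document; each statement's English description precedes it below -/
import Mathlib

section
/- Let (R,m) be an F-finite reduced excellent local ring of prime characteristic p > 0, let a ⊆ R be an ideal with a ∩ R° ≠ ∅, and let t ≥ 0 be a rational number. For each e ≥ 0 fix a system of generators x_1^{(e)}, …, x_{r_e}^{(e)} of the ideal a^{⌈t·p^e⌉}. Then for any element c ∈ R, the following are equivalent: (i) c ∈ τ̃(a^t); (ii) for every element d ∈ R° and every integer e_0 ≥ 0, there exist an integer e_1 ≥ e_0 and R-linear maps φ_i^{(e)} ∈ Hom_R(R^{1/p^e}, R) for e_0 ≤ e ≤ e_1 and 1 ≤ i ≤ r_e such that c = Σ_{e=e_0}^{e_1} Σ_{i=1}^{r_e} φ_i^{(e)}((d·x_i^{(e)})^{1/p^e}). -/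
open scoped TensorProduct

universe u

variable (R : Type u) [CommRing R]

/-- `R°`: the set of elements of `R` not contained in any minimal prime ideal. -/
def Rcirc : Set R := {c : R | ∀ P ∈ minimalPrimes R, c ∉ P}

/-- The Frobenius power `I^{[q]}`: the ideal generated by the `q`-th powers of elements of `I`. -/
def frobPow (I : Ideal R) (q : ℕ) : Ideal R := Ideal.span ((fun x : R => x ^ q) '' (I : Set R))

/-- The `a^t`-tight closure of an ideal `J`. -/
def tightClosure (p : ℕ) (a : Ideal R) (t : ℚ) (J : Ideal R) : Set R :=
  {z : R | ∃ c ∈ Rcirc R, ∃ e₀ : ℕ, ∀ e : ℕ, e₀ ≤ e →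
    ∀ x ∈ a ^ ⌈t * (p : ℚ) ^ e⌉₊, c * z ^ p ^ e * x ∈ frobPow R J (p ^ e)}

/-- The generalized test ideal `τ(a^t) = ⋂_J (J : J^{*aᵗ})`. -/
def testIdeal (p : ℕ) (a : Ideal R) (t : ℚ) : Ideal R :=
  ⨅ J : Ideal R, Submodule.colon J (Ideal.span (tightClosure R p a t J))

/-- `R` is F-finite: finitely generated over itself via the Frobenius endomorphism. -/
def FrobAlg (p e : ℕ) : Type u := R

instance : CommRing (FrobAlg R p e) := inferInstanceAs (CommRing R)

/-- The identity of `R`, viewed as a ring map `R →+* ᵉR`. -/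
def FrobAlg.of (p e : ℕ) : R →+* FrobAlg R p e := RingHom.id R

noncomputable instance [ExpChar R p] : Algebra R (FrobAlg R p e) :=
  ((FrobAlg.of R p e).comp (iterateFrobenius R p e)).toAlgebra

/-- F-finiteness of `R`. -/
def IsFFinite (p : ℕ) [ExpChar R p] : Prop := Module.Finite R (FrobAlg R p 1)

/-- `0^{*aᵗ}_M`, the `aᵗ`-tight closure of zero in a module `M`. -/
def moduleTC (p : ℕ) [ExpChar R p] (a : Ideal R) (t : ℚ)
    (M : Type u) [AddCommGroup M] [Module R M] : Set M :=
  {z : M | ∃ c ∈ Rcirc R, ∃ e₀ : ℕ, ∀ e : ℕ, e₀ ≤ e →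
    ∀ x ∈ a ^ ⌈t * (p : ℚ) ^ e⌉₊,
      (FrobAlg.of R p e (c * x)) ⊗ₜ[R] z = (0 : TensorProduct R (FrobAlg R p e) M)}

/-- `τ̃(aᵗ) = Ann_R (0^{*aᵗ}_E)`. -/
def tildeTau (p : ℕ) [ExpChar R p] (a : Ideal R) (t : ℚ)
    (E : Type u) [AddCommGroup E] [Module R E] : Ideal R :=
  (Submodule.span R (moduleTC R p a t E)).annihilator

/-- `E` is an injective hull of the `R`-module `M`. -/
def IsInjectiveHull (M : Type u) [AddCommGroup M] [Module R M]
    (E : Type u) [AddCommGroup E] [Module R E] : Prop :=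
  Module.Injective R E ∧
    ∃ ι : M →ₗ[R] E, Function.Injective ι ∧
      ∀ N : Submodule R E, N ≠ ⊥ → N ⊓ LinearMap.range ι ≠ ⊥

/-- `d` is an `aᵗ`-test element. -/
def IsTestElement (p : ℕ) [ExpChar R p] (a : Ideal R) (t : ℚ) (d : R) : Prop :=
  d ∈ Rcirc R ∧
    ∀ (M : Type u) [AddCommGroup M] [Module R M], Module.Finite R M →
      ∀ z : M, z ∈ moduleTC R p a t M ↔
        ∀ e : ℕ, ∀ x ∈ a ^ ⌈t * (p : ℚ) ^ e⌉₊,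
          (FrobAlg.of R p e (d * x)) ⊗ₜ[R] z = (0 : TensorProduct R (FrobAlg R p e) M)


theorem aux_inj {R : Type u} [CommRing R] {E : Type u} [AddCommGroup E] [Module R E]
    (hE : Module.Injective R E) {X Y : Type u} [AddCommGroup X] [Module R X]
    [AddCommGroup Y] [Module R Y] (f : X →ₗ[R] Y) (g : X →ₗ[R] E)
    (h : LinearMap.ker f ≤ LinearMap.ker g) : ∃ k : Y →ₗ[R] E, ∀ x, k (f x) = g x := by
  obtain ⟨k, hk⟩ := hE.out ((LinearMap.ker f).liftQ f le_rfl)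
    (LinearMap.ker_eq_bot.mp (Submodule.ker_liftQ_eq_bot _ _ _ le_rfl))
    ((LinearMap.ker f).liftQ g h)
  exact ⟨k, fun x => by simpa using hk ((LinearMap.ker f).mkQ x)⟩

theorem aux_easy {R : Type u} [CommRing R] {E M : Type u} [AddCommGroup E] [Module R E]
    [AddCommGroup M] [Module R M] (m : M) (z : E) (h : m ⊗ₜ[R] z = (0 : M ⊗[R] E))
    (φ : M →ₗ[R] R) : φ m • z = 0 := by
  have := congrArg (fun w => TensorProduct.lid R E (LinearMap.rTensor E φ w)) h
  simpa using this

theorem aux_hard {R : Type u} [CommRing R] [IsNoetherianRing R] {E M : Type u} [AddCommGroup E]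
    [Module R E] [AddCommGroup M] [Module R M] [Module.Finite R M]
    (hE : Module.Injective R E) (m : M) (z : E) (h : ∀ φ : M →ₗ[R] R, φ m • z = 0) :
    m ⊗ₜ[R] z = (0 : M ⊗[R] E) := by
  classical
  obtain ⟨n, π, hπ⟩ := Module.Finite.exists_fin' R M
  obtain ⟨s, k, hk⟩ := Submodule.fg_iff_exists_fin_generating_family.mp
    (IsNoetherian.noetherian (LinearMap.ker π))
  obtain ⟨v, rfl⟩ := hπ m
  have hkπ : ∀ j, π (k j) = 0 := fun j => by
    have : k j ∈ LinearMap.ker π := hk ▸ Submodule.subset_span ⟨j, rfl⟩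
    simpa using this
  -- the transpose map
  let f : (Fin n → R) →ₗ[R] (Fin s → R) := LinearMap.pi fun j =>
    ∑ i, (k j i) • LinearMap.proj (R := R) (φ := fun _ : Fin n => R) i
  let g : (Fin n → R) →ₗ[R] E :=
    (∑ i, (v i) • LinearMap.proj (R := R) (φ := fun _ : Fin n => R) i).smulRight z
  have hf : ∀ u j, f u j = ∑ i, k j i * u i := fun u j => by simp [f]
  have hg : ∀ u, g u = (∑ i, v i * u i) • z := fun u => by simp [g]
  have hfg : LinearMap.ker f ≤ LinearMap.ker g := by
    intro u hu
    rw [LinearMap.mem_ker] at hu ⊢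
    let L : (Fin n → R) →ₗ[R] R :=
      ∑ i, (u i) • LinearMap.proj (R := R) (φ := fun _ : Fin n => R) i
    have hL : ∀ w, L w = ∑ i, u i * w i := fun w => by simp [L]
    have hker : LinearMap.ker π ≤ LinearMap.ker L := by
      rw [← hk, Submodule.span_le]
      rintro _ ⟨j, rfl⟩
      have := congrFun hu j
      rw [hf] at this
      simp only [SetLike.mem_coe, LinearMap.mem_ker, hL]
      simpa [mul_comm] using this
    let φ : M →ₗ[R] R := ((LinearMap.ker π).liftQ L hker).comp
      (π.quotKerEquivOfSurjective hπ).symm.toLinearMap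
    have hφ : φ (π v) = L v := by
      have : (π.quotKerEquivOfSurjective hπ).symm (π v) = (LinearMap.ker π).mkQ v := by
        rw [LinearEquiv.symm_apply_eq]; rfl
      simp [φ, this]
    have := h φ
    rw [hφ, hL] at this
    rw [hg]
    simpa [mul_comm] using this
  obtain ⟨K, hK⟩ := aux_inj hE f g hfg
  let b : Fin n → M := fun i => π (Pi.single i 1)
  have hb : ∀ w, π w = ∑ i, w i • b i := fun w => by
    conv_lhs => rw [pi_eq_sum_univ' w]
    simp [b, map_sum]
  have hvz : ∀ i, v i • z = ∑ j, k j i • K (Pi.single j 1) := fun i => by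
    have h1 := hK (Pi.single i 1)
    rw [hg] at h1
    have h2 : f (Pi.single i 1) = ∑ j, k j i • Pi.single j (1 : R) := by
      ext j
      rw [hf]
      simp [Pi.single_apply, Finset.sum_apply]
    rw [h2] at h1
    simpa [Pi.single_apply] using h1.symm
  rw [hb, TensorProduct.sum_tmul]
  calc ∑ i, (v i • b i) ⊗ₜ[R] z = ∑ i, ∑ j, (k j i • b i) ⊗ₜ[R] K (Pi.single j 1) := by
        refine Finset.sum_congr rfl fun i _ => ?_
        rw [TensorProduct.smul_tmul, hvz, TensorProduct.tmul_sum]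
        exact Finset.sum_congr rfl fun j _ => (TensorProduct.smul_tmul _ _ _).symm
    _ = ∑ j, (∑ i, k j i • b i) ⊗ₜ[R] K (Pi.single j 1) := by
        rw [Finset.sum_comm]
        simp [TensorProduct.sum_tmul]
    _ = 0 := by
        refine Finset.sum_eq_zero fun j _ => ?_
        rw [← hb, hkπ, TensorProduct.zero_tmul]

theorem aux_cogen {R : Type u} [CommRing R] [IsLocalRing R] {E : Type u} [AddCommGroup E]
    [Module R E] (hE : IsInjectiveHull R (R ⧸ IsLocalRing.maximalIdeal R) E)
    (N : Ideal R) (c : R) (hc : c ∉ N) : ∃ z : E, (∀ n ∈ N, n • z = 0) ∧ c • z ≠ 0 := by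
  obtain ⟨hinj, ι, hι, -⟩ := hE
  let f : R →ₗ[R] (R ⧸ N) := N.mkQ.comp (LinearMap.mulRight R c)
  let g : R →ₗ[R] E := ι.comp (IsLocalRing.maximalIdeal R).mkQ
  have hf : ∀ y, f y = N.mkQ (y * c) := fun y => rfl
  have hfg : LinearMap.ker f ≤ LinearMap.ker g := by
    intro y hy
    rw [LinearMap.mem_ker, hf, Submodule.mkQ_apply, Submodule.Quotient.mk_eq_zero] at hy
    have hym : y ∈ IsLocalRing.maximalIdeal R := by
      rw [IsLocalRing.mem_maximalIdeal]
      intro hu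
      exact hc ((Ideal.unit_mul_mem_iff_mem N hu).mp hy)
    have : (IsLocalRing.maximalIdeal R).mkQ y = 0 := by
      rw [Submodule.mkQ_apply, Submodule.Quotient.mk_eq_zero]; exact hym
    simp only [LinearMap.mem_ker, g, LinearMap.comp_apply, this, map_zero]
  obtain ⟨k, hk⟩ := aux_inj hinj f g hfg
  refine ⟨k (N.mkQ 1), fun n hn => ?_, ?_⟩
  · rw [← map_smul, ← map_smul]
    have : N.mkQ (n • (1 : R)) = 0 := by
      rw [Submodule.mkQ_apply, Submodule.Quotient.mk_eq_zero]; simpa using hn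
    rw [this, map_zero]
  · rw [← map_smul, ← map_smul]
    have h1 := hk 1
    rw [hf] at h1
    have : (c • (1 : R)) = 1 * c := by simp
    rw [this, h1]
    intro h0
    have h2 : (IsLocalRing.maximalIdeal R).mkQ (1 : R) = 0 := hι (by simpa [g] using h0)
    rw [Submodule.mkQ_apply, Submodule.Quotient.mk_eq_zero] at h2
    exact (Ideal.ne_top_iff_one _).mp (IsLocalRing.maximalIdeal.isMaximal R).ne_top h2

theorem aux_finite {R : Type u} [CommRing R] (p : ℕ) [ExpChar R p] (h : IsFFinite R p) (e : ℕ) :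
    Module.Finite R (FrobAlg R p e) := by
  have h1 : (iterateFrobenius R p 1).Finite := h
  have h2 : ∀ e, (iterateFrobenius R p e).Finite := by
    intro e
    induction e with
    | zero => rw [iterateFrobenius_zero]; exact RingHom.Finite.id R
    | succ e ih =>
      have : iterateFrobenius R p (e + 1)
          = (iterateFrobenius R p e).comp (iterateFrobenius R p 1) := by
        ext y
        simp [iterateFrobenius_def, frobenius_def, pow_succ, ← pow_mul, mul_comm]
      rw [this]
      exact ih.comp h1
  exact h2 e

/-- **Key Lemma (i) ⇔ (ii)** (Hara–Takagi, Lemma 2.1).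
`(R,m)` an F-finite reduced (excellent) local ring of characteristic `p > 0`,
`a ⊆ R` an ideal meeting `R°`, `t ≥ 0` rational, `x^{(e)}_1, …, x^{(e)}_{r_e}` generators of
`a^{⌈t·p^e⌉}`.  Then `c ∈ τ̃(aᵗ)` iff for every `d ∈ R°` and `e₀ ≥ 0` there are `e₁ ≥ e₀` and
`R`-linear maps `φ⁽ᵉ⁾ᵢ : R^{1/pᵉ} → R` with `c = Σ_{e=e₀}^{e₁} Σ_i φ⁽ᵉ⁾ᵢ((d·x⁽ᵉ⁾ᵢ)^{1/pᵉ})`. -/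
theorem key_lemma_tilde_tau_characterization
    (p : ℕ) [Fact p.Prime] [CharP R p] [ExpChar R p]
    [IsNoetherianRing R] [IsReduced R] [IsLocalRing R]
    (hFF : IsFFinite R p)
    (a : Ideal R) (ha : ((a : Set R) ∩ Rcirc R).Nonempty)
    (t : ℚ) (ht : 0 ≤ t)
    (r : ℕ → ℕ) (x : ∀ e : ℕ, Fin (r e) → R)
    (hx : ∀ e : ℕ, Ideal.span (Set.range (x e)) = a ^ ⌈t * (p : ℚ) ^ e⌉₊)
    (E : Type u) [AddCommGroup E] [Module R E]
    (hE : IsInjectiveHull R (R ⧸ IsLocalRing.maximalIdeal R) E)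
    (c : R) :
    c ∈ tildeTau R p a t E ↔
      ∀ d ∈ Rcirc R, ∀ e₀ : ℕ, ∃ e₁ : ℕ, e₀ ≤ e₁ ∧
        ∃ φ : ∀ e : ℕ, Fin (r e) → (FrobAlg R p e →ₗ[R] R),
          c = ∑ e ∈ Finset.Icc e₀ e₁, ∑ i : Fin (r e),
            φ e i (FrobAlg.of R p e (d * x e i)) := by
  classical
  have hfin : ∀ e, Module.Finite R (FrobAlg R p e) := aux_finite p hFF
  constructor
  · intro hc d hd e₀
    let S : Set R := {y | ∃ e, e₀ ≤ e ∧ ∃ (i : Fin (r e)) (φ : FrobAlg R p e →ₗ[R] R),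
      y = φ (FrobAlg.of R p e (d * x e i))}
    have key : c ∈ Ideal.span S := by
      by_contra hcS
      obtain ⟨z, hz, hcz⟩ := aux_cogen hE _ c hcS
      apply hcz
      rw [tildeTau, Submodule.mem_annihilator] at hc
      refine hc z (Submodule.subset_span ⟨d, hd, e₀, fun e he y hy => ?_⟩)
      rw [← hx e] at hy
      have := hfin e
      induction hy using Submodule.span_induction with
      | mem y hy =>
        obtain ⟨i, rfl⟩ := hy
        exact aux_hard hE.1 _ _ fun φ => hz _ (Submodule.subset_span ⟨e, he, i, φ, rfl⟩)
      | zero => simp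
      | add y w _ _ hy hw => rw [mul_add, map_add, TensorProduct.add_tmul, hy, hw, add_zero]
      | smul b y _ hy =>
        have h3 := congrArg (fun w => (FrobAlg.of R p e b) • w) hy
        simp only [smul_zero, TensorProduct.smul_tmul'] at h3
        rw [← h3, smul_eq_mul, smul_eq_mul, ← map_mul]
        congr 2
        ring
    have main : ∃ e₁ : ℕ, e₀ ≤ e₁ ∧ ∃ φ : ∀ e : ℕ, Fin (r e) → (FrobAlg R p e →ₗ[R] R),
        ∀ e' ≥ e₁, c = ∑ e ∈ Finset.Icc e₀ e', ∑ i : Fin (r e),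
            φ e i (FrobAlg.of R p e (d * x e i)) := by
      clear hc
      induction key using Submodule.span_induction with
      | mem y hy =>
        obtain ⟨e, he, i, φ, rfl⟩ := hy
        refine ⟨e, he, Pi.single e (Pi.single i φ), fun e' he' => ?_⟩
        rw [Finset.sum_eq_single e, Finset.sum_eq_single i]
        · simp
        · intro j _ hj
          simp [hj]
        · simp
        · intro e2 _ h2
          simp [h2]
        · intro h2
          exact absurd (Finset.mem_Icc.mpr ⟨he, he'⟩) h2
      | zero => exact ⟨e₀, le_rfl, 0, fun e' _ => by simp⟩
      | add y w _ _ hy hw =>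
        obtain ⟨e1, h1, φ, hφ⟩ := hy
        obtain ⟨e2, h2, ψ, hψ⟩ := hw
        refine ⟨max e1 e2, le_max_of_le_left h1, φ + ψ, fun e' he' => ?_⟩
        conv_lhs => rw [hφ e' (le_of_max_le_left he'), hψ e' (le_of_max_le_right he')]
        simp [Finset.sum_add_distrib]
      | smul b y _ hy =>
        obtain ⟨e1, h1, φ, hφ⟩ := hy
        refine ⟨e1, h1, fun e i => b • φ e i, fun e' he' => ?_⟩
        conv_lhs => rw [hφ e' he']
        simp [Finset.mul_sum]
    obtain ⟨e₁, h1, φ, hφ⟩ := main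
    exact ⟨e₁, h1, φ, hφ e₁ le_rfl⟩
  · intro H
    rw [tildeTau, Submodule.mem_annihilator_span]
    rintro ⟨z, d, hd, e₀, hz⟩
    obtain ⟨e₁, -, φ, hc⟩ := H d hd e₀
    change c • z = 0
    rw [hc, Finset.sum_smul]
    refine Finset.sum_eq_zero fun e he => ?_
    rw [Finset.sum_smul]
    refine Finset.sum_eq_zero fun i _ => ?_
    refine aux_easy _ _ (hz e (Finset.mem_Icc.mp he).1 _ ?_) _
    rw [← hx e]
    exact Submodule.subset_span ⟨i, rfl⟩
end

section
/- Let (R,m) be an F-finite reduced excellent local ring of prime characteristic p > 0, and suppose that condition (*) is satisfied for the maximal ideal m (that is, τ(m) = τ̃(m)). Then τ(m) = R if and only if for every m-primary proper ideal a ⊂ R one has the strict containment a ⊊ τ(a). -/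
open scoped TensorProduct

universe u

variable (R : Type u) [CommRing R]

/-- **Corollary (HYQ)** (Hara–Takagi, Corollary 2.3, first assertion).
`(R,m)` F-finite reduced (excellent) local of characteristic `p > 0`, condition `(*)` for `m`.
Then `τ(m) = R` iff `a ⊊ τ(a)` for every `m`-primary proper ideal `a ⊂ R`. -/
theorem tau_maximalIdeal_eq_top_iff_strict_containment
    (p : ℕ) [Fact p.Prime] [CharP R p] [ExpChar R p]
    [IsNoetherianRing R] [IsReduced R] [IsLocalRing R]
    (hFF : IsFFinite R p)
    (E : Type u) [AddCommGroup E] [Module R E]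
    (hE : IsInjectiveHull R (R ⧸ IsLocalRing.maximalIdeal R) E)
    (hstar : testIdeal R p (IsLocalRing.maximalIdeal R) 1
      = tildeTau R p (IsLocalRing.maximalIdeal R) 1 E) :
    testIdeal R p (IsLocalRing.maximalIdeal R) 1 = ⊤ ↔
      ∀ a : Ideal R, a ≠ ⊤ → a.radical = IsLocalRing.maximalIdeal R →
        a < testIdeal R p a 1 := by
  constructor
  · intro htop a ha hrad
    set m := IsLocalRing.maximalIdeal R with hm
    have hclosed : ∀ J : Ideal R, ∀ w ∈ tightClosure R p m 1 J, w ∈ J := by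
      intro J w hw
      have h1 : (1 : R) ∈ testIdeal R p m 1 := by rw [htop]; trivial
      have h2 := (Submodule.mem_iInf _).1 h1 J
      have h3 := Submodule.mem_colon.1 h2 w (Ideal.subset_span hw)
      simpa using h3
    have key : ∀ y : R, (∀ x ∈ m, y * x ∈ a) → y ∈ testIdeal R p a 1 := by
      intro y hy
      refine (Submodule.mem_iInf _).2 fun J => Submodule.mem_colon.2 ?_
      intro z hz
      have hz' : z ∈ Ideal.span (tightClosure R p a 1 J) := hz
      refine Submodule.span_induction (p := fun z _ => y • z ∈ J) ?_ ?_ ?_ ?_ hz'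
      · rintro z ⟨c, hc, e₀, h⟩
        refine hclosed J _ ⟨c, hc, e₀, fun e he x hx => ?_⟩
        have hN : ⌈(1 : ℚ) * (p : ℚ) ^ e⌉₊ = p ^ e := by
          rw [one_mul, ← Nat.cast_pow, Nat.ceil_natCast]
        have hle : Ideal.span {y} * m ≤ a :=
          Ideal.span_singleton_mul_le_iff.2 hy
        have hyx : y ^ p ^ e * x ∈ a ^ ⌈(1 : ℚ) * (p : ℚ) ^ e⌉₊ := by
          rw [hN] at hx ⊢
          refine Ideal.pow_right_mono hle (p ^ e) ?_
          rw [mul_pow]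
          exact Ideal.mul_mem_mul
            (Ideal.pow_mem_pow (Ideal.mem_span_singleton_self y) _) hx
        have := h e he _ hyx
        have e1 : c * (y • z) ^ p ^ e * x = c * z ^ p ^ e * (y ^ p ^ e * x) := by
          rw [smul_eq_mul, mul_pow]; ring
        rw [e1]; exact this
      · simp
      · intro u v _ _ hu hv
        rw [smul_add]; exact J.add_mem hu hv
      · intro r u _ hu
        rw [smul_comm]; exact J.smul_mem r hu
    have hex : ∃ n, m ^ n ≤ a := by
      rw [← hrad]
      exact Ideal.exists_radical_pow_le_of_fg a (IsNoetherian.noetherian _)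
    classical
    obtain ⟨n, hn, hmin⟩ : ∃ n, m ^ n ≤ a ∧ ∀ k < n, ¬ m ^ k ≤ a :=
      ⟨Nat.find hex, Nat.find_spec hex, fun k hk => Nat.find_min hex hk⟩
    have hn0 : n ≠ 0 := by
      rintro rfl
      apply ha
      simpa using hn
    obtain ⟨k, rfl⟩ := Nat.exists_eq_succ_of_ne_zero hn0
    obtain ⟨y, hyk, hya⟩ := SetLike.not_le_iff_exists.1 (hmin k (Nat.lt_succ_self k))
    refine SetLike.lt_iff_le_and_exists.2
      ⟨fun x hx => key x fun w _ => a.mul_mem_right w hx, y, key y fun x hx => ?_, hya⟩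
    apply hn
    rw [Nat.succ_eq_add_one, pow_succ]
    exact Ideal.mul_mem_mul hyk hx
  · intro h
    exact (IsLocalRing.maximalIdeal.isMaximal R).1.2 _
      (h _ (IsLocalRing.maximalIdeal.isMaximal R).ne_top
        (IsLocalRing.maximalIdeal.isMaximal R).isPrime.radical)
end

section
/- Let (R,m) be an F-finite reduced excellent local ring of prime characteristic p > 0 such that condition (*) is satisfied for the maximal ideal m and τ(m) = R. Then for every ideal a ⊆ R with a ∩ R° ≠ ∅, one has (a :_R m) ⊆ τ(a). -/
open scoped TensorProduct

universe u

variable (R : Type u) [CommRing R]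

/-- (Hara–Takagi, proof of Corollary 2.3): if `(R,m)` is F-finite reduced (excellent) local with
condition `(*)` for `m` and `τ(m) = R`, then `(a :_R m) ⊆ τ(a)` for every ideal `a` with
`a ∩ R° ≠ ∅`. -/
theorem colon_maximalIdeal_le_testIdeal
    (p : ℕ) [Fact p.Prime] [CharP R p] [ExpChar R p]
    [IsNoetherianRing R] [IsReduced R] [IsLocalRing R]
    (hFF : IsFFinite R p)
    (E : Type u) [AddCommGroup E] [Module R E]
    (hE : IsInjectiveHull R (R ⧸ IsLocalRing.maximalIdeal R) E)
    (hstar : testIdeal R p (IsLocalRing.maximalIdeal R) 1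
      = tildeTau R p (IsLocalRing.maximalIdeal R) 1 E)
    (htop : testIdeal R p (IsLocalRing.maximalIdeal R) 1 = ⊤) :
    ∀ a : Ideal R, ((a : Set R) ∩ Rcirc R).Nonempty →
      Submodule.colon a (IsLocalRing.maximalIdeal R) ≤ testIdeal R p a 1 := by
  intro a _ r hr
  have hcl : ∀ J : Ideal R, ∀ z ∈ tightClosure R p (IsLocalRing.maximalIdeal R) 1 J, z ∈ J := by
    intro J z hz
    have h1 : (1 : R) ∈ testIdeal R p (IsLocalRing.maximalIdeal R) 1 := by
      rw [htop]; exact Submodule.mem_top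
    have h2 := (Submodule.mem_iInf _).1 h1 J
    have h3 := Submodule.mem_colon.1 h2 z (Ideal.subset_span hz)
    simpa using h3
  have hrm : Ideal.span {r} * IsLocalRing.maximalIdeal R ≤ a := by
    rw [Ideal.span_singleton_mul_le_iff]
    intro x hx
    exact Submodule.mem_colon.1 hr x hx
  refine (Submodule.mem_iInf _).2 fun J => Submodule.mem_colon.2 fun z hz => ?_
  have hspan : Ideal.span (tightClosure R p a 1 J) ≤ Submodule.comap (LinearMap.lsmul R R r) J := by
    refine Ideal.span_le.2 ?_
    rintro w ⟨c, hc, e₀, h⟩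
    refine hcl J _ ⟨c, hc, e₀, fun e he x hx => ?_⟩
    have hq : ⌈(1 : ℚ) * (p : ℚ) ^ e⌉₊ = p ^ e := by
      rw [one_mul, ← Nat.cast_pow, Nat.ceil_natCast]
    have hx2 : r ^ p ^ e * x ∈ a ^ ⌈(1 : ℚ) * (p : ℚ) ^ e⌉₊ := by
      rw [hq] at hx ⊢
      refine Ideal.pow_right_mono hrm (p ^ e) ?_
      rw [mul_pow]
      exact Ideal.mul_mem_mul (Ideal.pow_mem_pow (Ideal.mem_span_singleton_self r) _) hx
    have h4 := h e he _ hx2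
    have h5 : c * (r * w) ^ p ^ e * x = c * w ^ p ^ e * (r ^ p ^ e * x) := by ring
    simpa [h5] using h4
  exact hspan hz
end

section
/- Let (R,m) be an F-finite regular local ring of prime characteristic p > 0 with dim R ≥ 2. Then for every m-primary proper ideal a ⊂ R one has the strict containment a ⊊ τ(a). -/
open scoped TensorProduct

universe u

variable (R : Type u) [CommRing R]

/-- `(R,m)` is a regular local ring: Noetherian local and the maximal ideal is generated by
`dim R` elements. -/
def IsRegularLocal [IsLocalRing R] : Prop :=
  IsNoetherianRing R ∧
    ∃ (d : ℕ) (x : Fin d → R),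
      Ideal.span (Set.range x) = IsLocalRing.maximalIdeal R ∧ ringKrullDim R = d

open RingTheory.Sequence IsLocalRing

theorem Reg.pow_aux {R : Type*} [CommRing R] [IsLocalRing R] [IsNoetherianRing R] {M : Type*}
    [AddCommGroup M] [Module R M] [IsNoetherian R M] (n : ℕ)  :
    ∀ (B A : List R), (∀ r ∈ B ++ A, r ∈ maximalIdeal R) → n ≠ 0 → IsWeaklyRegular M (B ++ A) →
      IsWeaklyRegular M (B.map (· ^ n) ++ A) := by
  intro B
  induction B with
  | nil => intro A _ _ h; simpa using h
  | cons x B ih =>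
    intro A hm hn h
    have h1 : IsWeaklyRegular M ((B ++ A) ++ [x]) := by
      refine isWeaklyRegular_of_perm_of_subset_maximalIdeal h ?_ hm
      exact (List.perm_append_singleton x (B ++ A)).symm
    have h2 : IsWeaklyRegular M ((B ++ A) ++ [x ^ n]) := by
      rw [isWeaklyRegular_append_iff] at h1 ⊢
      refine ⟨h1.1, ?_⟩
      rw [isWeaklyRegular_singleton_iff] at *
      exact h1.2.pow n
    have hx : x ^ n ∈ maximalIdeal R := Ideal.pow_mem_of_mem _ (hm x (by simp)) n (Nat.pos_of_ne_zero hn)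
    have hm' : ∀ r ∈ B ++ (A ++ [x ^ n]), r ∈ maximalIdeal R := by
      intro r hr
      simp only [List.mem_append, List.mem_singleton] at hr
      rcases hr with hr | hr | rfl
      · exact hm r (by simp [hr])
      · exact hm r (by simp [hr])
      · exact hx
    have h3 := ih (A ++ [x ^ n]) hm' hn (by simpa using h2)
    refine isWeaklyRegular_of_perm_of_subset_maximalIdeal h3 ?_ ?_
    · rw [← List.append_assoc]
      exact (List.perm_append_singleton _ _)
    · intro r hr
      simp only [List.mem_append, List.mem_map, List.mem_singleton] at hr
      rcases hr with ⟨s, hs, rfl⟩ | hr | rfl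
      · exact Ideal.pow_mem_of_mem _ (hm s (by simp [hs])) n (Nat.pos_of_ne_zero hn)
      · exact hm r (by simp [hr])
      · exact hx

theorem Reg.prod_pow {R : Type*} [CommRing R] [IsLocalRing R] [IsNoetherianRing R] (n : ℕ)  :
    ∀ (l A : List R), (∀ r ∈ l ++ A, r ∈ maximalIdeal R) → IsWeaklyRegular R (l ++ A) →
      l.prod ^ n ∉ Ideal.ofList (l.map (· ^ (n + 1)) ++ A) := by
  intro l
  induction l with
  | nil =>
    intro A hm h h1
    simp at h1
    have : Ideal.ofList A ≤ maximalIdeal R := by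
      rw [Ideal.ofList, Ideal.span_le]
      intro r hr; exact hm r (by simpa using hr)
    exact (Ideal.ne_top_iff_one _).1 (maximalIdeal.isMaximal R).ne_top (this h1)
  | cons x l ih =>
    intro A hm h h1
    have h2 : IsWeaklyRegular R (l ++ (A ++ [x])) := by
      refine isWeaklyRegular_of_perm_of_subset_maximalIdeal h ?_ hm
      rw [← List.append_assoc]
      exact (List.perm_append_singleton x (l ++ A)).symm
    have hm' : ∀ r ∈ l ++ (A ++ [x]), r ∈ maximalIdeal R := by
      intro r hr
      apply hm
      simp only [List.mem_append, List.mem_cons] at hr ⊢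
      tauto
    apply ih (A ++ [x]) hm' h2
    have h3 := Reg.pow_aux (n + 1) l (A ++ [x]) hm' (by simp) h2
    rw [← List.append_assoc, isWeaklyRegular_append_iff, isWeaklyRegular_singleton_iff] at h3
    have h4 := h3.2.pow n
    rw [List.map_cons, List.cons_append, Ideal.ofList_cons, List.prod_cons,
      Ideal.mem_span_singleton_sup] at h1
    obtain ⟨s, b, hb, hs⟩ := h1
    rw [isSMulRegular_quotient_iff_mem_of_smul_mem] at h4
    have h5 := h4 (l.prod ^ n - s * x) (by
      rw [smul_eq_mul, smul_eq_mul, Ideal.mul_top]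
      convert hb using 1
      linear_combination -hs)
    rw [smul_eq_mul, Ideal.mul_top] at h5
    rw [← List.append_assoc, Ideal.ofList_append, Ideal.ofList_singleton, sup_comm,
      Ideal.mem_span_singleton_sup]
    exact ⟨s, _, h5, by ring⟩

theorem Reg.exchange {R : Type*} [CommRing R] [IsLocalRing R] :
    ∀ (l : List R) (x : R), x ∈ Ideal.ofList l → x ∉ maximalIdeal R * Ideal.ofList l →
      ∃ l' : List R, l'.length + 1 = l.length ∧ Ideal.ofList (x :: l') = Ideal.ofList l := by
  intro l
  induction l with
  | nil =>
    intro x hx hx'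
    rw [Ideal.ofList_nil, Ideal.mem_bot] at hx
    subst hx
    exact absurd (zero_mem _) hx'
  | cons y t ih =>
    intro x hx hx'
    rw [Ideal.ofList_cons, Ideal.mem_span_singleton_sup] at hx
    obtain ⟨r, s, hs, rfl⟩ := hx
    by_cases hr : IsUnit r
    · refine ⟨t, rfl, ?_⟩
      rw [Ideal.ofList_cons, Ideal.ofList_cons]
      apply le_antisymm
      · rw [sup_le_iff, Ideal.span_singleton_le_iff_mem, Ideal.mem_span_singleton_sup]
        exact ⟨⟨r, s, hs, rfl⟩, le_sup_right⟩
      · rw [sup_le_iff, Ideal.span_singleton_le_iff_mem, Ideal.mem_span_singleton_sup]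
        refine ⟨?_, le_sup_right⟩
        obtain ⟨v, hv⟩ := hr.exists_left_inv
        refine ⟨v, -(v * s), neg_mem (Ideal.mul_mem_left _ _ hs), ?_⟩
        linear_combination y * hv
    · have hr' : r ∈ maximalIdeal R := hr
      have hs' : s ∉ maximalIdeal R * Ideal.ofList t := by
        intro h
        apply hx'
        rw [Ideal.ofList_cons, Ideal.mul_sup]
        exact add_mem (Ideal.mem_sup_left (Ideal.mul_mem_mul hr' (Ideal.mem_span_singleton_self y)))
          (Ideal.mem_sup_right h)
      obtain ⟨t', ht', h⟩ := ih s hs hs'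
      refine ⟨y :: t', by simp [ht'], ?_⟩
      rw [Ideal.ofList_cons y t, ← h]
      simp only [Ideal.ofList_cons]
      apply le_antisymm
      · simp only [sup_le_iff, Ideal.span_singleton_le_iff_mem]
        refine ⟨add_mem ?_ ?_, ?_, ?_⟩
        · exact Ideal.mem_sup_left (Ideal.mul_mem_left _ _ (Ideal.mem_span_singleton_self y))
        · exact Ideal.mem_sup_right (Ideal.mem_sup_left (Ideal.mem_span_singleton_self s))
        · exact Ideal.mem_sup_left (Ideal.mem_span_singleton_self y)
        · exact le_sup_of_le_right le_sup_right
      · simp only [sup_le_iff, Ideal.span_singleton_le_iff_mem]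
        refine ⟨?_, ?_, ?_⟩
        · exact Ideal.mem_sup_right (Ideal.mem_sup_left (Ideal.mem_span_singleton_self y))
        · rw [← Ideal.add_mem_iff_right (a := r * y)]
          · exact Ideal.mem_sup_left (Ideal.mem_span_singleton_self _)
          exact Ideal.mem_sup_right (Ideal.mem_sup_left (Ideal.mul_mem_left _ _ (Ideal.mem_span_singleton_self y)))
        · exact le_sup_of_le_right le_sup_right

theorem Reg.isLocalRing_quot {R : Type*} [CommRing R] [IsLocalRing R] {x : R}
    (hx : x ∈ maximalIdeal R) : IsLocalRing (R ⧸ Ideal.span {x}) := by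
  have : Nontrivial (R ⧸ Ideal.span {x}) := by
    rw [Ideal.Quotient.nontrivial_iff]
    intro h
    rw [Ideal.span_singleton_eq_top] at h
    exact hx h
  exact .of_surjective' _ Ideal.Quotient.mk_surjective

theorem Reg.quot_max {R : Type*} [CommRing R] [IsLocalRing R] {x : R} {l : List R}
    (hm : Ideal.ofList (x :: l) = maximalIdeal R)  [IsLocalRing (R ⧸ Ideal.span {x})] :
    Ideal.ofList (l.map (Ideal.Quotient.mk (Ideal.span {x}))) = maximalIdeal (R ⧸ Ideal.span {x}) := by
  have h1 : Ideal.map (Ideal.Quotient.mk (Ideal.span {x})) (maximalIdeal R) = maximalIdeal _ := by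
    rw [map_maximalIdeal_of_surjective _ Ideal.Quotient.mk_surjective]
  rw [← Ideal.map_ofList, ← h1, ← hm, Ideal.ofList_cons, Ideal.map_sup]
  simp [Ideal.map_span]

theorem Reg.quot_dim {R : Type*} [CommRing R] [IsLocalRing R] [IsNoetherianRing R] {x : R} {n : ℕ}
    (hx : x ∈ maximalIdeal R) (hn : ((n + 1 : ℕ) : WithBot ℕ∞) ≤ ringKrullDim R) :
    (n : WithBot ℕ∞) ≤ ringKrullDim (R ⧸ Ideal.span {x}) := by
  have h := ringKrullDim_le_ringKrullDim_quotient_add_card (R := R) {x}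
    (by rw [ringJacobson_eq_maximalIdeal]; simpa using hx)
  rw [Finset.coe_singleton, Finset.card_singleton] at h
  have h2 := hn.trans h
  push_cast at h2
  exact ENat.WithBot.add_le_add_one_right_iff.1 h2

theorem Reg.isDomain {n : ℕ} : ∀ {R : Type u} [CommRing R] [IsLocalRing R] [IsNoetherianRing R]
    (l : List R), l.length = n →
    Ideal.ofList l = maximalIdeal R → (n : WithBot ℕ∞) ≤ ringKrullDim R → IsDomain R := by
  induction n with
  | zero =>
    intro R _ _ _ l hl hm _
    obtain rfl := List.length_eq_zero_iff.1 hl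
    rw [Ideal.ofList_nil] at hm
    exact ((isField_iff_maximalIdeal_eq).2 hm.symm).isDomain
  | succ n ih =>
    intro R _ _ _ l hl hm hn
    have hmin : ∀ Q ∈ minimalPrimes R, ¬ maximalIdeal R ≤ Q := by
      intro Q hQ hle
      have hQm : Q = maximalIdeal R := ((maximalIdeal.isMaximal R).eq_of_le hQ.1.1.ne_top hle).symm
      have h0 : (maximalIdeal R).height = 0 := by
        exact Ideal.height_eq_zero_iff.2 (hQm ▸ hQ)
      rw [← maximalIdeal_height_eq_ringKrullDim, h0] at hn
      norm_cast at hn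
    have hsq : ¬ maximalIdeal R ≤ maximalIdeal R * maximalIdeal R := by
      intro h
      have : maximalIdeal R = ⊥ := by
        apply Submodule.eq_bot_of_le_smul_of_le_jacobson_bot (maximalIdeal R) _
          (IsNoetherian.noetherian _) h
        rw [jacobson_eq_maximalIdeal ⊥ bot_ne_top]
      obtain ⟨Q, hQ⟩ := Ideal.nonempty_minimalPrimes (I := (⊥ : Ideal R)) bot_ne_top
      exact hmin Q hQ (this ▸ bot_le)
    obtain ⟨x, hxm, hxs, hxQ⟩ : ∃ x ∈ maximalIdeal R, x ∉ maximalIdeal R * maximalIdeal R ∧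
        ∀ Q ∈ minimalPrimes R, x ∉ Q := by
      by_contra! hcon
      have hfin : (minimalPrimes R).Finite := Ideal.finite_minimalPrimes_of_isNoetherianRing R ⊥
      classical
      have := (Ideal.subset_union_prime (s := insert (maximalIdeal R * maximalIdeal R) hfin.toFinset)
        (f := id) (maximalIdeal R * maximalIdeal R) (maximalIdeal R * maximalIdeal R)
        (I := maximalIdeal R) (by
          intro i hi h1 _
          simp only [Finset.mem_insert, h1, false_or, Set.Finite.mem_toFinset] at hi
          exact hi.1.1)).1 (by
          intro x hx
          simp only [Set.mem_iUnion]
          by_cases hxs : x ∈ maximalIdeal R * maximalIdeal R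
          · exact ⟨_, by simp, hxs⟩
          · obtain ⟨Q, hQ, hxQ⟩ := hcon x hx hxs
            exact ⟨Q, by simp [hQ], hxQ⟩)
      obtain ⟨i, hi, hle⟩ := this
      simp only [Finset.mem_insert, Set.Finite.mem_toFinset] at hi
      rcases hi with rfl | hi
      · exact hsq hle
      · exact hmin i hi hle
    obtain ⟨l', hl', hm'⟩ := Reg.exchange l x (hm ▸ hxm) (hm ▸ hxs)
    rw [hm] at hm'
    have := Reg.isLocalRing_quot hxm
    have hdom : IsDomain (R ⧸ Ideal.span {x}) :=
      ih (l'.map (Ideal.Quotient.mk (Ideal.span {x}))) (by simp; omega) (Reg.quot_max hm')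
        (Reg.quot_dim hxm hn)
    rw [Ideal.Quotient.isDomain_iff_prime] at hdom
    obtain ⟨Q, hQ, hQx⟩ := Ideal.exists_minimalPrimes_le (I := ⊥) (J := Ideal.span {x}) bot_le
    have hxnQ := hxQ Q hQ
    have hQp : Q.IsPrime := hQ.1.1
    have : Q = ⊥ := by
      apply Submodule.eq_bot_of_le_smul_of_le_jacobson_bot (Ideal.span {x}) _
        (IsNoetherian.noetherian _)
      · intro y hy
        obtain ⟨r, rfl⟩ := Ideal.mem_span_singleton'.1 (hQx hy)
        have hr : r ∈ Q := (hQp.mem_or_mem hy).resolve_right hxnQ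
        rw [mul_comm]
        exact Ideal.mul_mem_mul (Ideal.mem_span_singleton_self x) hr
      · rw [jacobson_eq_maximalIdeal ⊥ bot_ne_top, Ideal.span_singleton_le_iff_mem]
        exact hxm
    rw [this] at hQp
    exact IsDomain.of_bot_isPrime R

open Pointwise in
theorem Reg.weaklyRegular {n : ℕ} : ∀ {R : Type u} [CommRing R] [IsLocalRing R] [IsNoetherianRing R]
    (l : List R), l.length = n →
    Ideal.ofList l = maximalIdeal R → (n : WithBot ℕ∞) ≤ ringKrullDim R → IsWeaklyRegular R l := by
  induction n with
  | zero =>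
    intro R _ _ _ l hl hm _
    obtain rfl := List.length_eq_zero_iff.1 hl
    exact .nil R R
  | succ n ih =>
    intro R _ _ _ l hl hm hn
    have hdom := Reg.isDomain l hl hm hn
    cases l with
    | nil => simp at hl
    | cons x l =>
      have hxm : x ∈ maximalIdeal R := by
        rw [← hm]; exact Ideal.subset_span (by simp)
      have := Reg.isLocalRing_quot hxm
      have hl' : l.length = n := by simpa using hl
      have h1 := ih (l.map (Ideal.Quotient.mk (Ideal.span {x}))) (by simpa using hl') (Reg.quot_max hm)
        (Reg.quot_dim hxm hn)
      have hx0 : x ≠ 0 := by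
        rintro rfl
        rw [Ideal.ofList_cons] at hm
        have hm2 : Ideal.ofList l = maximalIdeal R := by simpa using hm
        have h3 := ringKrullDim_le_spanFinrank_maximalIdeal R
        classical
        have h4 : (maximalIdeal R).spanFinrank ≤ n := by
          rw [← hm2, ← hl']
          refine (Submodule.spanFinrank_span_le_ncard_of_finite (List.finite_toSet l)).trans ?_
          have : {r | r ∈ l} = (l.toFinset : Set R) := by ext; simp
          rw [this, Set.ncard_coe_finset]
          exact List.toFinset_card_le l
        have h5 := hn.trans h3
        have h6 : n + 1 ≤ (maximalIdeal R).spanFinrank := by exact_mod_cast h5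
        omega
      rw [isWeaklyRegular_cons_iff]
      refine ⟨IsSMulRegular.of_ne_zero hx0, ?_⟩
      have h2 := (isWeaklyRegular_map_algebraMap_iff (R := R) (R ⧸ Ideal.span {x}) (R ⧸ Ideal.span {x}) l).1 h1
      have he : Ideal.span {x} = x • (⊤ : Ideal R) := by simp [← Submodule.ideal_span_singleton_smul]
      exact ((Submodule.quotEquivOfEq _ _ he).isWeaklyRegular_congr l).1 h2

theorem Reg.free {n : ℕ} : ∀ {R : Type u} [CommRing R] [IsLocalRing R] [IsNoetherianRing R]
    {M : Type u} [AddCommGroup M] [Module R M] [Module.Finite R M] (l : List R), l.length = n →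
    Ideal.ofList l = maximalIdeal R → IsWeaklyRegular M l → Module.Free R M := by
  induction n with
  | zero =>
    intro R _ _ _ M _ _ _ l hl hm _
    obtain rfl := List.length_eq_zero_iff.1 hl
    rw [Ideal.ofList_nil] at hm
    have : IsField R := (isField_iff_maximalIdeal_eq).2 hm.symm
    let := this.toField
    exact Module.Free.of_divisionRing R M
  | succ n ih =>
    intro R _ _ _ M _ _ _ l hl hm h
    cases l with
    | nil => simp at hl
    | cons x l =>
      rw [isWeaklyRegular_cons_iff'] at h
      have hx : x ∈ maximalIdeal R := by
        rw [← hm]; exact Ideal.subset_span (by simp)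
      have := Reg.isLocalRing_quot hx
      have : Module.FinitePresentation R M := Module.finitePresentation_of_finite R M
      rw [← Module.free_quotSMulTop_iff_free (x := x) R M _ h.1]
      · have := Module.Finite.of_restrictScalars_finite R (R ⧸ Ideal.span {x}) (QuotSMulTop x M)
        apply ih _ _ _ h.2
        · simpa using hl
        · exact Reg.quot_max hm
      · rw [jacobson_eq_maximalIdeal ⊥ bot_ne_top]
        exact hx

theorem Frob.frobPow_eq {R : Type u} [CommRing R] (p : ℕ) [ExpChar R p] (J : Ideal R) (e : ℕ) :
    frobPow R J (p ^ e) = J.map (iterateFrobenius R p e) := rfl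

theorem Frob.pow_mem {R : Type u} [CommRing R] {J : Ideal R} {x : R} (hx : x ∈ J) (q : ℕ) :
    x ^ q ∈ frobPow R J q := Ideal.subset_span ⟨x, hx, rfl⟩

theorem Frob.mono {R : Type u} [CommRing R] {I J : Ideal R} (h : I ≤ J) (q : ℕ) :
    frobPow R I q ≤ frobPow R J q := Ideal.span_mono (Set.image_mono h)

theorem Frob.frobPow_comp {R : Type u} [CommRing R] (p : ℕ) [ExpChar R p] (J : Ideal R) (e f : ℕ) :
    frobPow R (frobPow R J (p ^ e)) (p ^ f) = frobPow R J (p ^ (e + f)) := by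
  simp only [Frob.frobPow_eq]
  rw [Ideal.map_map]
  congr 1
  ext x
  simp [iterateFrobenius_def, ← pow_mul, pow_add]

theorem Frob.le_pow {R : Type u} [CommRing R] (J : Ideal R) (q : ℕ) :
    frobPow R J q ≤ J ^ q := by
  rw [frobPow, Ideal.span_le]
  rintro _ ⟨x, hx, rfl⟩
  exact Ideal.pow_mem_pow hx q

/-- `(J^{[p]} : w^p) ⊆ (J : w)^{[p]}` when Frobenius is free. -/
theorem Frob.colon_one {R : Type u} [CommRing R] (p : ℕ) [ExpChar R p]
    [Module.Finite R (FrobAlg R p 1)] [Module.Free R (FrobAlg R p 1)] (J : Ideal R) (w r : R)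
    (h : w ^ p * r ∈ frobPow R J p) : r ∈ frobPow R (J.colon {w}) p := by
  have hsmul : ∀ x y : R, (x • (FrobAlg.of R p 1 y) : FrobAlg R p 1) = FrobAlg.of R p 1 (x ^ p * y) := by
    intro x y
    rw [Algebra.smul_def, map_mul]
    congr 1
    change FrobAlg.of R p 1 (iterateFrobenius R p 1 x) = _
    simp [frobenius_def]
  let b := Module.Free.chooseBasis R (FrobAlg R p 1)
  have key : ∀ s ∈ frobPow R J p, ∀ (t : R) i, b.repr (FrobAlg.of R p 1 (t * s)) i ∈ J := by
    intro s hs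
    induction hs using Submodule.span_induction with
    | mem x hx =>
      obtain ⟨y, hy, rfl⟩ := hx
      intro t i
      have := hsmul y t
      simp only
      rw [mul_comm t, ← this, map_smul, Finsupp.smul_apply, smul_eq_mul]
      exact Ideal.mul_mem_right _ _ hy
    | zero => simp
    | add x y _ _ hx hy =>
      intro t i
      rw [mul_add, map_add, map_add, Finsupp.add_apply]
      exact add_mem (hx t i) (hy t i)
    | smul a x _ hx =>
      intro t i
      rw [smul_eq_mul, ← mul_assoc]
      exact hx _ i
  have h1 := key _ h 1
  have h2 : ∀ i, b.repr (FrobAlg.of R p 1 r) i ∈ J.colon {w} := by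
    intro i
    have := h1 i
    rw [one_mul, ← hsmul, map_smul, Finsupp.smul_apply, smul_eq_mul] at this
    rw [Submodule.mem_colon_singleton, smul_eq_mul, mul_comm]
    exact this
  have h3 : ∃ g : _ → R, ∑ i, (b.repr (FrobAlg.of R p 1 r) i) ^ p * g i = r := by
    refine ⟨fun i => (b i : FrobAlg R p 1), ?_⟩
    have := b.sum_repr (FrobAlg.of R p 1 r)
    have e : ∀ i, (b.repr (FrobAlg.of R p 1 r) i) • b i =
        FrobAlg.of R p 1 ((b.repr (FrobAlg.of R p 1 r) i) ^ p * (show R from b i)) :=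
      fun i => hsmul _ _
    simp only [e] at this
    rw [← map_sum] at this
    exact this
  obtain ⟨g, hg⟩ := h3
  rw [← hg]
  exact sum_mem fun i _ => Ideal.mul_mem_right _ _ (Frob.pow_mem (h2 i) p)

theorem Frob.colon {R : Type u} [CommRing R] (p : ℕ) [ExpChar R p]
    [Module.Finite R (FrobAlg R p 1)] [Module.Free R (FrobAlg R p 1)] (J : Ideal R) (w : R) (e : ℕ) :
    ∀ r : R, w ^ p ^ e * r ∈ frobPow R J (p ^ e) → r ∈ frobPow R (J.colon {w}) (p ^ e) := by
  induction e with
  | zero =>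
    intro r h
    rw [Frob.frobPow_eq] at h ⊢
    simp only [iterateFrobenius_zero, Ideal.map_id, pow_zero, pow_one] at h ⊢
    rw [Submodule.mem_colon_singleton, smul_eq_mul, mul_comm]
    exact h
  | succ e ih =>
    intro r h
    rw [← Frob.frobPow_comp p _ e 1, pow_one] at h ⊢
    rw [pow_succ, pow_mul] at h
    refine Frob.mono ?_ _ (Frob.colon_one p _ _ _ h)
    intro s hs
    rw [Submodule.mem_colon_singleton, smul_eq_mul, mul_comm] at hs
    exact ih s hs

theorem Frob.tc_trivial {R : Type u} [CommRing R] [IsLocalRing R] [IsNoetherianRing R]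
    (p : ℕ) [Fact p.Prime] [ExpChar R p]
    [Module.Finite R (FrobAlg R p 1)] [Module.Free R (FrobAlg R p 1)] (J : Ideal R) (z c : R)
    (hc : c ≠ 0) (e₀ : ℕ) (h : ∀ e, e₀ ≤ e → c * z ^ p ^ e ∈ frobPow R J (p ^ e)) : z ∈ J := by
  by_contra hz
  apply hc
  have hle : J.colon {z} ≤ maximalIdeal R := by
    apply le_maximalIdeal
    rw [Ideal.ne_top_iff_one, Submodule.mem_colon_singleton]
    simpa using hz
  have : c ∈ (⨅ i : ℕ, maximalIdeal R ^ i) := by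
    rw [Submodule.mem_iInf]
    intro i
    have h1 := h (max e₀ i) (le_max_left _ _)
    rw [mul_comm] at h1
    have h2 := Frob.le_pow _ _ (Frob.mono hle _ (Frob.colon p J z _ c h1))
    refine Ideal.pow_le_pow_right ?_ h2
    exact (le_max_right _ _).trans (Nat.lt_pow_self (Fact.out : p.Prime).one_lt).le
  rw [Ideal.iInf_pow_eq_bot_of_isLocalRing _ (maximalIdeal.isMaximal R).ne_top] at this
  simpa using this

theorem Frob.free {R : Type u} [CommRing R] [IsLocalRing R] [IsNoetherianRing R]
    (p : ℕ) [Fact p.Prime] [ExpChar R p]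
    [Module.Finite R (FrobAlg R p 1)] (l : List R) (hm : Ideal.ofList l = maximalIdeal R)
    (hreg : IsWeaklyRegular R l) : Module.Free R (FrobAlg R p 1) := by
  apply Reg.free l rfl hm
  have hl : ∀ r ∈ l, r ∈ maximalIdeal R := fun r hr => hm ▸ Ideal.subset_span hr
  have h1 := Reg.pow_aux (M := R) p l [] (by simpa using hl) (Fact.out : p.Prime).ne_zero (by simpa using hreg)
  rw [List.append_nil] at h1
  let e : R ≃+ FrobAlg R p 1 := AddEquiv.refl R
  refine (AddEquiv.isWeaklyRegular_congr (e := e) ?_).1 h1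
  rw [List.forall₂_map_left_iff, List.forall₂_same]
  intro r hr x
  rw [Algebra.smul_def]
  change (r ^ p * x : R) = (iterateFrobenius R p 1 r) * x
  simp [frobenius_def]

theorem Frob.pow_mul_mem {R : Type u} [CommRing R] (a m : Ideal R) (z : R)
    (hz : ∀ y ∈ m, z * y ∈ a) (n : ℕ) (y : R) (hy : y ∈ m ^ n) : z ^ n * y ∈ a ^ n := by
  have h1 : Ideal.span {z} * m ≤ a := by
    rw [Ideal.span_singleton_mul_le_iff]; exact hz
  have h2 := Ideal.pow_right_mono h1 n
  rw [mul_pow, Ideal.span_singleton_pow] at h2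
  exact h2 (Ideal.mul_mem_mul (Ideal.mem_span_singleton_self _) hy)

theorem Frob.colon_le_testIdeal {R : Type u} [CommRing R] [IsLocalRing R] [IsNoetherianRing R]
    (p : ℕ) [Fact p.Prime] [ExpChar R p]
    [Module.Finite R (FrobAlg R p 1)] [Module.Free R (FrobAlg R p 1)] (u : R)
    (hu : u ∈ maximalIdeal R ^ p) (hu' : u ∉ frobPow R (maximalIdeal R) p)
    (a : Ideal R) (z : R) (hz : ∀ y ∈ maximalIdeal R, z * y ∈ a) :
    z ∈ testIdeal R p a 1 := by
  rw [testIdeal, Submodule.mem_iInf]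
  intro J
  rw [Ideal.span, Submodule.colon_span, Submodule.mem_colon]
  rintro w ⟨c, hc, e₀, h⟩
  have hceil : ∀ e : ℕ, ⌈(1 : ℚ) * (p : ℚ) ^ e⌉₊ = p ^ e := by
    intro e
    rw [one_mul]
    exact_mod_cast Nat.ceil_natCast (R := ℚ) (p ^ e)
  simp only [hceil] at h
  have hc0 : c ≠ 0 := by
    rintro rfl
    obtain ⟨Q, hQ⟩ := Ideal.nonempty_minimalPrimes (I := (⊥ : Ideal R)) bot_ne_top
    exact hc Q hQ (zero_mem _)
  have ha : ∀ y ∈ a, y * w ∈ J := by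
    intro y hy
    apply Frob.tc_trivial p J _ c hc0 e₀
    intro e he
    have := h e he (y ^ p ^ e) (Ideal.pow_mem_pow hy _)
    rwa [mul_pow, mul_comm (y ^ p ^ e), ← mul_assoc]
  by_contra hzw
  rw [smul_eq_mul] at hzw
  have hle : J.colon {z * w} ≤ maximalIdeal R := by
    apply le_maximalIdeal
    rw [Ideal.ne_top_iff_one, Submodule.mem_colon_singleton]
    simpa using hzw
  apply hu'
  refine Frob.mono hle _ (Frob.colon_one p J (z * w) u ?_)
  apply Frob.tc_trivial p _ _ c hc0 e₀
  intro e he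
  have hcomp := Frob.frobPow_comp p J 1 e
  rw [pow_one] at hcomp
  rw [hcomp]
  have hue : u ^ p ^ e ∈ maximalIdeal R ^ (p ^ (1 + e)) := by
    rw [pow_add, pow_one, pow_mul]
    exact Ideal.pow_mem_pow hu _
  have := h (1 + e) (by omega) _ (Frob.pow_mul_mem a _ z hz _ _ hue)
  convert this using 1
  rw [pow_add p 1 e, pow_one, mul_pow, mul_pow, mul_pow, ← pow_mul, ← pow_mul]
  ring

/-- (Hara–Takagi, Corollary 2.3, second assertion): if `(R,m)` is an F-finite regular local ring
of characteristic `p > 0` with `dim R ≥ 2`, then `a ⊊ τ(a)` for every `m`-primary proper ideal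
`a ⊂ R`. -/
theorem strict_containment_of_regular_dim_ge_two
    (p : ℕ) [Fact p.Prime] [CharP R p] [ExpChar R p]
    [IsLocalRing R] (hreg : IsRegularLocal R)
    (hFF : IsFFinite R p)
    (hdim : 2 ≤ ringKrullDim R) :
    ∀ a : Ideal R, a ≠ ⊤ → a.radical = IsLocalRing.maximalIdeal R →
      a < testIdeal R p a 1 := by
  intro a ha hrad
  obtain ⟨hN, d, x, hx, hd⟩ := hreg
  have hp : p.Prime := Fact.out
  have : Module.Finite R (FrobAlg R p 1) := hFF
  have hd2 : 2 ≤ d := by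
    rw [hd] at hdim; exact_mod_cast hdim
  have hm : Ideal.ofList (List.ofFn x) = maximalIdeal R := by
    rw [← hx]
    exact congrArg Ideal.span (Set.ext fun r => by simp [List.mem_ofFn])
  have hl : ∀ r ∈ List.ofFn x, r ∈ maximalIdeal R := fun r hr => hm ▸ Ideal.subset_span hr
  have hw : IsWeaklyRegular R (List.ofFn x) := Reg.weaklyRegular _ (by simp) hm hd.ge
  have := Frob.free p _ hm hw
  have hu' := Reg.prod_pow (p - 1) (List.ofFn x) [] (by simpa using hl) (by simpa using hw)
  rw [Nat.sub_add_cancel hp.one_le, List.append_nil] at hu'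
  have hu2 : (List.ofFn x).prod ^ (p - 1) ∉ frobPow R (maximalIdeal R) p := by
    intro h
    apply hu'
    have h1 := Frob.frobPow_eq (R := R) p (maximalIdeal R) 1
    rw [pow_one] at h1
    rw [h1, ← hm, Ideal.map_ofList] at h
    convert h using 3
    ext r
    simp [frobenius_def]
  have hu : (List.ofFn x).prod ^ (p - 1) ∈ maximalIdeal R ^ p := by
    have h1 : (List.ofFn x).prod ∈ maximalIdeal R ^ d := by
      have : ∀ l : List R, (∀ r ∈ l, r ∈ maximalIdeal R) → l.prod ∈ maximalIdeal R ^ l.length := by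
        intro l
        induction l with
        | nil => simp
        | cons y l ih =>
          intro h
          rw [List.prod_cons, List.length_cons, pow_succ']
          exact Ideal.mul_mem_mul (h y (by simp)) (ih fun r hr => h r (by simp [hr]))
      simpa using this _ hl
    have h2 := Ideal.pow_mem_pow h1 (p - 1)
    rw [← pow_mul] at h2
    refine Ideal.pow_le_pow_right ?_ h2
    have := hp.two_le
    calc p ≤ 2 * (p - 1) := by omega
      _ ≤ d * (p - 1) := Nat.mul_le_mul_right _ hd2
  have hle := Frob.colon_le_testIdeal p _ hu hu2 a
  have hex : ∃ n, maximalIdeal R ^ n ≤ a := by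
    rw [← hrad]
    exact Ideal.exists_radical_pow_le_of_fg a (IsNoetherian.noetherian _)
  classical
  have hn0 : Nat.find hex ≠ 0 := by
    intro h0
    have := Nat.find_spec hex
    rw [h0, pow_zero, Ideal.one_eq_top, top_le_iff] at this
    exact ha this
  have hlt : ¬ maximalIdeal R ^ (Nat.find hex - 1) ≤ a := Nat.find_min hex (by omega)
  obtain ⟨z, hz, hza⟩ := SetLike.not_le_iff_exists.1 hlt
  rw [SetLike.lt_iff_le_and_exists]
  refine ⟨fun y hy => hle y fun s _ => Ideal.mul_mem_right _ _ hy, z, hle z fun y hy => ?_, hza⟩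
  apply Nat.find_spec hex
  have := Ideal.mul_mem_mul hz hy
  rwa [← pow_succ, Nat.sub_add_cancel (Nat.one_le_iff_ne_zero.2 hn0)] at this
end

section
/- Let (R,m) be an F-finite reduced excellent local ring of prime characteristic p > 0, and suppose that condition (*) is satisfied for the unit ideal R. Let c ∈ τ(R) ∩ R° be a test element. Then for every ideal a ⊆ R with a ∩ R° ≠ ∅, every rational number t ≥ 0, every ideal J ⊆ R, every z ∈ J^{*a^t}, and every power q = p^e of p, one has c·z^q·a^{⌈tq⌉} ⊆ J^{[q]}. In particular, c is an a^t-test element for all such a and t. -/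
open scoped TensorProduct

universe u

variable (R : Type u) [CommRing R]

lemma frobAlg_smul (p : ℕ) [ExpChar R p] (e : ℕ) (r s : R) :
    r • FrobAlg.of R p e s = FrobAlg.of R p e (r ^ p ^ e * s) := by
  rw [Algebra.smul_def, map_mul]
  rfl

lemma frobAlg_finite (p : ℕ) [ExpChar R p] (hFF : IsFFinite R p) (e : ℕ) :
    Module.Finite R (FrobAlg R p e) := by
  have h1 : (frobenius R p).Finite := by
    have h : (iterateFrobenius R p 1).Finite := hFF
    rwa [iterateFrobenius_one] at h
  have h : ∀ e, (iterateFrobenius R p e).Finite := by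
    intro e
    induction e with
    | zero => rw [iterateFrobenius_zero]; exact RingHom.Finite.id R
    | succ n ih => rw [iterateFrobenius_add, iterateFrobenius_one]; exact ih.comp h1
  exact h e

/-- If every functional on `S` sends `d` into the annihilator of `z` then `d ⊗ z = 0`. -/
lemma tmul_eq_zero_of_injective [IsNoetherianRing R]
    (S : Type u) [AddCommGroup S] [Module R S] [Module.Finite R S]
    (E : Type u) [AddCommGroup E] [Module R E] (hE : Module.Injective R E)
    (d : S) (z : E) (h : ∀ φ : S →ₗ[R] R, φ d • z = 0) :
    d ⊗ₜ[R] z = (0 : S ⊗[R] E) := by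
  classical
  obtain ⟨n, π, hπ⟩ := Module.Finite.exists_fin' R S
  obtain ⟨m, k, hk⟩ := Submodule.fg_iff_exists_fin_generating_family.mp
    (IsNoetherian.noetherian (LinearMap.ker π))
  obtain ⟨v, rfl⟩ := hπ d
  -- pairing with the relations
  let B : (Fin n → R) →ₗ[R] (Fin m → R) :=
    LinearMap.pi fun j => Fintype.linearCombination R (k j)
  have hB : ∀ a j, B a j = ∑ i, a i * k j i := by
    intro a j
    simp [B, Fintype.linearCombination_apply]
  let G : (Fin n → R) →ₗ[R] E := Fintype.linearCombination R (fun i => v i • z)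
  have hG : ∀ a, G a = (∑ i, a i * v i) • z := by
    intro a
    simp [G, Fintype.linearCombination_apply, Finset.sum_smul, mul_smul]
  have hker : LinearMap.ker B ≤ LinearMap.ker G := by
    intro a ha
    have ha' : ∀ j, ∑ i, a i * k j i = 0 := by
      intro j
      rw [← hB, LinearMap.mem_ker.mp ha]; rfl
    let ψ : (Fin n → R) →ₗ[R] R := Fintype.linearCombination R a
    have hψ : ∀ w, ψ w = ∑ i, a i * w i := by
      intro w
      simp [ψ, Fintype.linearCombination_apply, mul_comm]
    have hle : LinearMap.ker π ≤ LinearMap.ker ψ := by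
      rw [← hk, Submodule.span_le]
      rintro _ ⟨j, rfl⟩
      rw [SetLike.mem_coe, LinearMap.mem_ker, hψ]
      exact ha' j
    let φ : S →ₗ[R] R :=
      ((LinearMap.ker π).liftQ ψ hle) ∘ₗ (π.quotKerEquivOfSurjective hπ).symm.toLinearMap
    have hφ : φ (π v) = ψ v := by
      have : (π.quotKerEquivOfSurjective hπ).symm (π v) = (LinearMap.ker π).mkQ v := by
        rw [LinearEquiv.symm_apply_eq]; rfl
      simp [φ, this]
    have := h φ
    rw [hφ, hψ] at this
    rw [LinearMap.mem_ker, hG, this]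
  obtain ⟨w, hw⟩ := hE.out ((LinearMap.ker B).liftQ B le_rfl)
    (by rw [← LinearMap.ker_eq_bot]; exact Submodule.ker_liftQ_eq_bot _ _ _ le_rfl)
    ((LinearMap.ker B).liftQ G hker)
  have hw' : ∀ a, w (B a) = G a := fun a => hw ((LinearMap.ker B).mkQ a)
  have hvz : ∀ i, v i • z = ∑ j, k j i • w (Pi.single j 1) := by
    intro i
    have h1 := hw' (Pi.single i 1)
    rw [hG] at h1
    have h2 : B (Pi.single i 1) = ∑ j, k j i • (Pi.single j 1 : Fin m → R) := by
      ext j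
      rw [hB]
      simp [Pi.single_apply, Finset.sum_apply]
    rw [h2] at h1
    simp only [map_sum, map_smul] at h1
    rw [h1]
    simp [Pi.single_apply]
  have hsum : ∀ u : Fin n → R, π u = ∑ i, u i • π (Pi.single i 1) := by
    intro u
    conv_lhs => rw [pi_eq_sum_univ' u]
    simp [map_sum]
  calc (π v) ⊗ₜ[R] z = ∑ i, π (Pi.single i 1) ⊗ₜ[R] (v i • z) := by
        rw [hsum v, TensorProduct.sum_tmul]
        simp [TensorProduct.smul_tmul]
    _ = ∑ j, (π (k j)) ⊗ₜ[R] w (Pi.single j 1) := by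
        simp_rw [hvz, TensorProduct.tmul_sum]
        rw [Finset.sum_comm]
        refine Finset.sum_congr rfl fun j _ => ?_
        rw [hsum (k j), TensorProduct.sum_tmul]
        simp [TensorProduct.smul_tmul]
    _ = 0 := by
        refine Finset.sum_eq_zero fun j _ => ?_
        have : k j ∈ LinearMap.ker π := by
          rw [← hk]; exact Submodule.subset_span ⟨j, rfl⟩
        rw [LinearMap.mem_ker.mp this, TensorProduct.zero_tmul]

/-- `E` cogenerates. -/
lemma exists_detect [IsLocalRing R]
    (E : Type u) [AddCommGroup E] [Module R E]
    (hE : IsInjectiveHull R (R ⧸ IsLocalRing.maximalIdeal R) E)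
    (I : Ideal R) (c : R) (hc : c ∉ I) :
    ∃ z : E, (∀ r ∈ I, r • z = 0) ∧ c • z ≠ 0 := by
  obtain ⟨hinj, ι, hι, -⟩ := hE
  let f : R →ₗ[R] R ⧸ I := LinearMap.toSpanSingleton R (R ⧸ I) (I.mkQ c)
  have hf : ∀ r, f r = I.mkQ (r * c) := by
    intro r
    rw [LinearMap.toSpanSingleton_apply, ← map_smul]; rfl
  let g : R →ₗ[R] E := ι ∘ₗ (IsLocalRing.maximalIdeal R).mkQ
  have hle : LinearMap.ker f ≤ LinearMap.ker g := by
    intro r hr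
    have hr' : r * c ∈ I := by
      rw [LinearMap.mem_ker, hf] at hr
      exact (Submodule.Quotient.mk_eq_zero I).mp hr
    have : r ∈ IsLocalRing.maximalIdeal R := by
      rw [IsLocalRing.mem_maximalIdeal, mem_nonunits_iff]
      intro hu
      exact hc ((Ideal.unit_mul_mem_iff_mem I hu).mp hr')
    have h0 : (IsLocalRing.maximalIdeal R).mkQ r = 0 :=
      (Submodule.Quotient.mk_eq_zero _).mpr this
    simp [g, LinearMap.mem_ker, h0]
  obtain ⟨h, hh⟩ := hinj.out ((LinearMap.ker f).liftQ f le_rfl)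
    (by rw [← LinearMap.ker_eq_bot]; exact Submodule.ker_liftQ_eq_bot _ _ _ le_rfl)
    ((LinearMap.ker f).liftQ g hle)
  have hh' : ∀ r, h (f r) = g r := fun r => hh ((LinearMap.ker f).mkQ r)
  have hz : ∀ r : R, r • h (I.mkQ 1) = h (I.mkQ r) := by
    intro r
    rw [← map_smul, ← map_smul]; simp
  refine ⟨h (I.mkQ 1), fun r hr => ?_, ?_⟩
  · rw [hz, show I.mkQ r = 0 from (Submodule.Quotient.mk_eq_zero I).mpr hr, map_zero]
  · rw [hz]
    have h1 := hh' 1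
    rw [hf, one_mul] at h1
    rw [h1]
    intro h0
    have h2 : (IsLocalRing.maximalIdeal R).mkQ 1 = 0 := hι (by rw [map_zero]; exact h0)
    have h3 : (1 : R) ∈ IsLocalRing.maximalIdeal R := (Submodule.Quotient.mk_eq_zero _).mp h2
    exact (IsLocalRing.mem_maximalIdeal (1 : R)).mp h3 isUnit_one

/-- The set of values at `d` of functionals on the Frobenius pushforwards. -/
def traceSet (p : ℕ) [ExpChar R p] (d : R) (e₀ : ℕ) : Set R :=
  {y | ∃ e, e₀ ≤ e ∧ ∃ φ : FrobAlg R p e →ₗ[R] R, y = φ (FrobAlg.of R p e d)}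

lemma mem_span_traceSet (p : ℕ) [ExpChar R p] [IsNoetherianRing R] [IsLocalRing R]
    (hFF : IsFFinite R p)
    (E : Type u) [AddCommGroup E] [Module R E]
    (hE : IsInjectiveHull R (R ⧸ IsLocalRing.maximalIdeal R) E)
    (c : R) (hc : c ∈ tildeTau R p ⊤ 1 E) (d : R) (hd : d ∈ Rcirc R) (e₀ : ℕ) :
    c ∈ Submodule.span R (traceSet R p d e₀) := by
  by_contra hcI
  obtain ⟨z, hz, hcz⟩ := exists_detect R E hE (Submodule.span R (traceSet R p d e₀)) c hcI
  apply hcz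
  refine Submodule.mem_annihilator.mp hc z (Submodule.subset_span ?_)
  refine ⟨d, hd, e₀, fun e he x _ => ?_⟩
  haveI := frobAlg_finite R p hFF e
  apply tmul_eq_zero_of_injective R _ E hE.1
  intro φ
  refine hz _ (Submodule.subset_span ⟨e, he,
    φ ∘ₗ LinearMap.mulRight R (FrobAlg.of R p e x), ?_⟩)
  simp

lemma ceil_aux (p : ℕ) (t : ℚ) (e f : ℕ) :
    ⌈t * (p : ℚ) ^ (e + f)⌉₊ ≤ ⌈t * (p : ℚ) ^ e⌉₊ * p ^ f := by
  rw [Nat.ceil_le]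
  push_cast
  rw [pow_add, ← mul_assoc]
  exact mul_le_mul_of_nonneg_right (Nat.le_ceil _) (by positivity)

lemma pow_mem_aux (p : ℕ) (a : Ideal R) (t : ℚ) (e f : ℕ) (x : R)
    (hx : x ∈ a ^ ⌈t * (p : ℚ) ^ e⌉₊) : x ^ p ^ f ∈ a ^ ⌈t * (p : ℚ) ^ (e + f)⌉₊ := by
  refine Ideal.pow_le_pow_right (ceil_aux p t e f) ?_
  rw [pow_mul]
  exact Ideal.pow_mem_pow hx _

/-- A functional on `ᶠR`, regarded as an `R`-linear map `ᵉ⁺ᶠR → ᵉR`. -/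
noncomputable def liftFunctional (p : ℕ) [ExpChar R p] (e f : ℕ) (φ : FrobAlg R p f →ₗ[R] R) :
    FrobAlg R p (e + f) →ₗ[R] FrobAlg R p e where
  toFun s := FrobAlg.of R p e (φ (FrobAlg.of R p f (show R from s)))
  map_add' s s' := by
    rw [← map_add, ← map_add]
    rfl
  map_smul' r s := by
    have h1 : (show R from r • s) = r ^ p ^ (e + f) * (show R from s) :=
      frobAlg_smul R p (e + f) r s
    rw [h1, RingHom.id_apply, frobAlg_smul, pow_add, pow_mul, ← frobAlg_smul, map_smul, smul_eq_mul]

lemma module_key (p : ℕ) [ExpChar R p] [IsNoetherianRing R] [IsLocalRing R]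
    (hFF : IsFFinite R p)
    (E : Type u) [AddCommGroup E] [Module R E]
    (hE : IsInjectiveHull R (R ⧸ IsLocalRing.maximalIdeal R) E)
    (c : R) (hc : c ∈ tildeTau R p ⊤ 1 E) (a : Ideal R) (t : ℚ)
    (M : Type u) [AddCommGroup M] [Module R M] (z : M) (hz : z ∈ moduleTC R p a t M)
    (e : ℕ) (x : R) (hx : x ∈ a ^ ⌈t * (p : ℚ) ^ e⌉₊) :
    (FrobAlg.of R p e (c * x)) ⊗ₜ[R] z = (0 : TensorProduct R (FrobAlg R p e) M) := by
  obtain ⟨d, hd, e₀, h⟩ := hz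
  have hcs := mem_span_traceSet R p hFF E hE c hc d hd e₀
  clear hc
  induction hcs using Submodule.span_induction with
  | mem y hy =>
    obtain ⟨f, hf, φ, rfl⟩ := hy
    have h1 := h (e + f) (by omega) _ (pow_mem_aux R p a t e f x hx)
    have h2 := congrArg ((liftFunctional R p e f φ).rTensor M) h1
    rw [map_zero, LinearMap.rTensor_tmul] at h2
    rw [← h2]
    congr 1
    change _ = FrobAlg.of R p e (φ (FrobAlg.of R p f (d * x ^ p ^ f)))
    rw [mul_comm d, ← frobAlg_smul, map_smul, smul_eq_mul, mul_comm]
  | zero => simp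
  | add y y' _ _ ih ih' => rw [add_mul, map_add, TensorProduct.add_tmul, ih, ih', add_zero]
  | smul r y _ ih =>
    rw [smul_eq_mul, mul_assoc, map_mul, ← smul_eq_mul, ← TensorProduct.smul_tmul', ih, smul_zero]

lemma ideal_key (p : ℕ) [ExpChar R p] [IsNoetherianRing R] [IsLocalRing R]
    (hFF : IsFFinite R p)
    (E : Type u) [AddCommGroup E] [Module R E]
    (hE : IsInjectiveHull R (R ⧸ IsLocalRing.maximalIdeal R) E)
    (c : R) (hc : c ∈ tildeTau R p ⊤ 1 E) (a : Ideal R) (t : ℚ)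
    (J : Ideal R) (z : R) (hz : z ∈ tightClosure R p a t J)
    (e : ℕ) (x : R) (hx : x ∈ a ^ ⌈t * (p : ℚ) ^ e⌉₊) :
    c * z ^ p ^ e * x ∈ frobPow R J (p ^ e) := by
  obtain ⟨d, hd, e₀, h⟩ := hz
  have hcs := mem_span_traceSet R p hFF E hE c hc d hd e₀
  clear hc
  induction hcs using Submodule.span_induction with
  | mem y hy =>
    obtain ⟨f, hf, φ, rfl⟩ := hy
    have h1 := h (e + f) (by omega) _ (pow_mem_aux R p a t e f x hx)
    have h2 : ∀ y ∈ frobPow R J (p ^ (e + f)), φ (FrobAlg.of R p f y) ∈ frobPow R J (p ^ e) := by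
      intro y hy
      refine Submodule.span_induction (p := fun y _ => ∀ r : R,
        φ (FrobAlg.of R p f (r * y)) ∈ frobPow R J (p ^ e)) ?_ ?_ ?_ ?_ hy 1 |> fun h => by
          simpa using h
      · rintro _ ⟨j, hj, rfl⟩ r
        change φ (FrobAlg.of R p f (r * j ^ p ^ (e + f))) ∈ _
        rw [mul_comm, pow_add, pow_mul, ← frobAlg_smul, map_smul, smul_eq_mul]
        exact Ideal.mul_mem_right _ _ (Ideal.subset_span ⟨j, hj, rfl⟩)
      · intro r; simp
      · intro y y' _ _ ih ih' r
        rw [mul_add, map_add, map_add]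
        exact Ideal.add_mem _ (ih r) (ih' r)
      · intro s y _ ih r
        rw [smul_eq_mul, ← mul_assoc]
        exact ih _
    have h3 := h2 _ h1
    have h4 : d * z ^ p ^ (e + f) * x ^ p ^ f = (z ^ p ^ e * x) ^ p ^ f * d := by
      rw [mul_pow, pow_add, pow_mul]; ring
    rw [h4, ← frobAlg_smul, map_smul, smul_eq_mul] at h3
    convert h3 using 1
    ring
  | zero => simp
  | add y y' _ _ ih ih' =>
    rw [add_mul, add_mul]; exact Ideal.add_mem _ ih ih'
  | smul r y _ ih =>
    rw [smul_eq_mul, mul_assoc, mul_assoc, ← mul_assoc y]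
    exact Ideal.mul_mem_left _ _ ih

/-- **Corollary 2.4** (Hara–Takagi).  `(R,m)` F-finite reduced (excellent) local of
characteristic `p > 0`, condition `(*)` for the unit ideal.  If `c ∈ τ(R) ∩ R°` is a test
element, then for every ideal `a` with `a ∩ R° ≠ ∅`, every rational `t ≥ 0`, every ideal `J`,
every `z ∈ J^{*aᵗ}` and every `q = pᵉ`, one has `c·z^q·a^{⌈tq⌉} ⊆ J^{[q]}`; in particular `c`
is an `aᵗ`-test element for all such `a` and `t`. -/
theorem test_element_is_a_pow_t_test_element
    (p : ℕ) [Fact p.Prime] [CharP R p] [ExpChar R p]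
    [IsNoetherianRing R] [IsReduced R] [IsLocalRing R]
    (hFF : IsFFinite R p)
    (E : Type u) [AddCommGroup E] [Module R E]
    (hE : IsInjectiveHull R (R ⧸ IsLocalRing.maximalIdeal R) E)
    (hstar : testIdeal R p ⊤ 1 = tildeTau R p ⊤ 1 E)
    (c : R) (hc : c ∈ testIdeal R p ⊤ 1) (hc' : c ∈ Rcirc R) :
    (∀ a : Ideal R, ((a : Set R) ∩ Rcirc R).Nonempty → ∀ t : ℚ, 0 ≤ t →
      ∀ J : Ideal R, ∀ z ∈ tightClosure R p a t J, ∀ e : ℕ,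
        ∀ x ∈ a ^ ⌈t * (p : ℚ) ^ e⌉₊, c * z ^ p ^ e * x ∈ frobPow R J (p ^ e)) ∧
    (∀ a : Ideal R, ((a : Set R) ∩ Rcirc R).Nonempty → ∀ t : ℚ, 0 ≤ t →
      IsTestElement R p a t c) := by
  rw [hstar] at hc
  refine ⟨fun a _ t _ J z hz e x hx => ideal_key R p hFF E hE c hc a t J z hz e x hx,
    fun a _ t _ => ⟨hc', ?_⟩⟩
  intro M _ _ _ z
  exact ⟨fun hz e x hx => module_key R p hFF E hE c hc a t M z hz e x hx,
    fun h => ⟨c, hc', 0, fun e _ x hx => h e x hx⟩⟩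
end

section
/- Let (R,m) be an F-finite reduced excellent local ring of prime characteristic p > 0, let a ⊆ R be an ideal with a ∩ R° ≠ ∅, let t ≥ 0 be a rational number, and let W be a multiplicatively closed subset of R. Suppose that condition (*) is satisfied for a^t over R and for (a·R_W)^t over the localization R_W. Then τ((a·R_W)^t) = τ(a^t)·R_W. -/
open scoped TensorProduct

universe u

variable (R : Type u) [CommRing R]

/-! ### Core: `p^{-e}`-linear maps -/

/-- `φ` is a `p^{-e}`-linear additive endomorphism of `S`. -/
def IsPLin {S : Type u} [CommRing S] (p e : ℕ) (φ : S →+ S) : Prop :=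
  ∀ r x : S, φ (r ^ p ^ e * x) = r * φ x

section core
variable {S : Type u} [CommRing S] {p : ℕ}

theorem IsPLin.comp {e e' : ℕ} {φ ψ : S →+ S} (hφ : IsPLin p e φ) (hψ : IsPLin p e' ψ) :
    IsPLin p (e + e') (φ.comp ψ) := by
  intro r x
  simp only [AddMonoidHom.comp_apply]
  rw [pow_add, pow_mul, hψ, hφ]

theorem IsPLin.mulRight {e : ℕ} {φ : S →+ S} (hφ : IsPLin p e φ) (s : S) :
    IsPLin p e (φ.comp (AddMonoidHom.mulLeft s)) := by
  intro r x
  simp only [AddMonoidHom.comp_apply, AddMonoidHom.coe_mulLeft]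
  rw [mul_left_comm, hφ]

theorem IsPLin.mulLeft {e : ℕ} {φ : S →+ S} (hφ : IsPLin p e φ) (s : S) :
    IsPLin p e ((AddMonoidHom.mulLeft s).comp φ) := by
  intro r x
  simp only [AddMonoidHom.comp_apply, AddMonoidHom.coe_mulLeft]
  rw [mul_left_comm, hφ]

theorem IsPLin.add {e : ℕ} {φ ψ : S →+ S} (hφ : IsPLin p e φ) (hψ : IsPLin p e ψ) :
    IsPLin p e (φ + ψ) := by
  intro r x
  simp only [AddMonoidHom.add_apply]
  rw [hφ, hψ, mul_add]

theorem IsPLin.zero {e : ℕ} : IsPLin p e (0 : S →+ S) := by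
  intro r x; simp

theorem IsPLin.id : IsPLin p 0 (AddMonoidHom.id S) := by
  intro r x; simp

/-- The ideal of values `φ d`. -/
def valIdeal (p e : ℕ) (d : S) : Ideal S where
  carrier := {y | ∃ φ : S →+ S, IsPLin p e φ ∧ φ d = y}
  zero_mem' := ⟨0, IsPLin.zero, rfl⟩
  add_mem' := by
    rintro _ _ ⟨φ, hφ, rfl⟩ ⟨ψ, hψ, rfl⟩
    exact ⟨φ + ψ, hφ.add hψ, rfl⟩
  smul_mem' := by
    rintro c _ ⟨φ, hφ, rfl⟩
    exact ⟨_, hφ.mulLeft c, rfl⟩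

theorem mem_valIdeal {e : ℕ} {d y : S} :
    y ∈ valIdeal p e d ↔ ∃ φ : S →+ S, IsPLin p e φ ∧ φ d = y := Iff.rfl

/-- `c` admits a finite dual basis: `c • id` on `F_* S` factors through a finite free module. -/
def DualBasis (p : ℕ) (c : S) : Prop :=
  ∃ (n : ℕ) (φ : Fin n → (S →+ S)) (b : Fin n → S), (∀ i, IsPLin p 1 (φ i)) ∧
    ∀ f : S, c ^ p * f = ∑ i, φ i f ^ p * b i

theorem frobPow_mono {I J : Ideal S} (h : I ≤ J) (q : ℕ) : frobPow S I q ≤ frobPow S J q :=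
  Ideal.span_mono (Set.image_mono h)

theorem frobPow_le_pow (I : Ideal S) (q : ℕ) : frobPow S I q ≤ I ^ q := by
  refine Ideal.span_le.mpr ?_
  rintro _ ⟨x, hx, rfl⟩
  exact Ideal.pow_mem_pow hx q

theorem frobPow_pow [ExpChar S p] (I : Ideal S) (q : ℕ) {y : S} (hy : y ∈ frobPow S I q) :
    y ^ p ∈ frobPow S I (q * p) := by
  have : frobPow S I q ≤ (frobPow S I (q * p)).comap (frobenius S p) := by
    refine Ideal.span_le.mpr ?_
    rintro _ ⟨x, hx, rfl⟩
    refine Ideal.subset_span ⟨x, hx, ?_⟩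
    simp [frobenius_def, pow_mul]
  exact this hy

theorem DualBasis.mem_frobPow [ExpChar S p] (hp : 2 ≤ p) {c : S} (hc : DualBasis p c) (e : ℕ) :
    ∀ f : S, c ^ (2 * p ^ e - 2) * f ∈ frobPow S (valIdeal p e f) (p ^ e) := by
  obtain ⟨n, φ, b, hφ, hb⟩ := hc
  induction e with
  | zero =>
    intro f
    simp only [pow_zero, mul_one, Nat.sub_self, one_mul]
    exact Ideal.subset_span ⟨f, ⟨_, IsPLin.id, rfl⟩, by simp⟩
  | succ e ih =>
    intro f
    have h1 : ∀ i, c ^ ((2 * p ^ e - 2) * p) * φ i f ^ p ∈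
        frobPow S (valIdeal p (e + 1) f) (p ^ (e + 1)) := by
      intro i
      have h2 : valIdeal p e (φ i f) ≤ valIdeal p (e + 1) f := by
        rintro _ ⟨ψ, hψ, rfl⟩
        exact ⟨_, hψ.comp (hφ i), rfl⟩
      have h3 := frobPow_pow (p := p) _ _ (frobPow_mono h2 _ (ih (φ i f)))
      rw [mul_pow, ← pow_mul, ← pow_succ] at h3
      exact h3
    have h4 : c ^ ((2 * p ^ e - 2) * p + p) * f ∈
        frobPow S (valIdeal p (e + 1) f) (p ^ (e + 1)) := by
      rw [pow_add c, mul_assoc, hb, Finset.mul_sum]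
      refine Ideal.sum_mem _ fun i _ => ?_
      rw [← mul_assoc]
      exact Ideal.mul_mem_right _ _ (h1 i)
    have h5 : (2 * p ^ e - 2) * p + p ≤ 2 * p ^ (e + 1) - 2 := by
      have : 1 ≤ p ^ e := Nat.one_le_pow _ _ (by omega)
      obtain ⟨k, hk⟩ := Nat.exists_eq_add_of_le this
      rw [pow_succ, hk]
      have : 2 * (1 + k) - 2 = 2 * k := by omega
      rw [this]
      apply Nat.le_sub_of_add_le
      nlinarith
    rw [← Nat.sub_add_cancel h5, pow_add c, mul_assoc]
    exact Ideal.mul_mem_left _ _ h4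

/-- Splitting up to `c ^ p`. -/
theorem DualBasis.exists_split [ExpChar S p] (hp : 2 ≤ p) {c : S} (hc : DualBasis p c) :
    ∃ φ : S →+ S, IsPLin p 1 φ ∧ φ 1 = c ^ p := by
  obtain ⟨n, φ, b, hφ, hb⟩ := hc
  have : c ^ p ∈ valIdeal p 1 (1 : S) := by
    have h := hb 1
    rw [mul_one] at h
    rw [h]
    refine Ideal.sum_mem _ fun i _ => Ideal.mul_mem_right _ _ ?_
    exact Ideal.pow_mem_of_mem _ (mem_valIdeal.mpr ⟨_, hφ i, rfl⟩) _ (by omega)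
  exact this

theorem split_step {g : S} {φ₁ : S →+ S} (h₁ : IsPLin p 1 φ₁) (hg : φ₁ 1 = g)
    {e M m : ℕ} (hM : M ≤ p * m) {d : S} (h : g ^ M ∈ valIdeal p e d) :
    g ^ (m + 1) ∈ valIdeal p (e + 1) d := by
  obtain ⟨ψ, hψ, hd⟩ := h
  refine ⟨φ₁.comp ((AddMonoidHom.mulLeft (g ^ (p * m - M))).comp ψ), ?_, ?_⟩
  · rw [add_comm e 1]; exact h₁.comp (hψ.mulLeft _)
  · simp only [AddMonoidHom.comp_apply, AddMonoidHom.coe_mulLeft, hd]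
    rw [← pow_add, Nat.sub_add_cancel hM, mul_comm p m, pow_mul]
    have := h₁ (g ^ m) 1
    rw [pow_one, mul_one, hg] at this
    rw [this, pow_succ]

theorem pow_three_mem (hp : 2 ≤ p) {g : S} {φ₁ : S →+ S} (h₁ : IsPLin p 1 φ₁) (hg : φ₁ 1 = g)
    {d : S} (M : ℕ) : ∀ e : ℕ, g ^ (3 + M) ∈ valIdeal p e d → ∀ e₀ : ℕ, ∃ e' : ℕ, e₀ ≤ e' ∧
      g ^ 3 ∈ valIdeal p e' d := by
  induction M with
  | zero =>
    intro e h e₀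
    have : ∀ k, g ^ 3 ∈ valIdeal p (e + k) d := by
      intro k
      induction k with
      | zero => exact h
      | succ k ih => exact split_step h₁ hg (M := 3) (m := 2) (by omega) ih
    exact ⟨e + e₀, by omega, this e₀⟩
  | succ M ih =>
    intro e h
    apply ih (e + 1)
    have := split_step h₁ hg (M := 3 + (M + 1)) (m := M + 2) (by nlinarith) h
    rwa [show 3 + M = M + 2 + 1 by omega]

theorem valIdeal_shift {g : S} {φ₁ : S →+ S} (h₁ : IsPLin p 1 φ₁) (hg : φ₁ 1 = g) (hp : 2 ≤ p)
    {e : ℕ} {d y : S} (h : y ∈ valIdeal p e d) : g * y ∈ valIdeal p (e + 1) d := by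
  obtain ⟨φ, hφ, rfl⟩ := h
  refine ⟨(φ.comp φ₁).comp (AddMonoidHom.mulLeft (d ^ (p - 1) * g ^ (p * (p ^ e - 1)))),
    (hφ.comp h₁).mulRight _, ?_⟩
  simp only [AddMonoidHom.comp_apply, AddMonoidHom.coe_mulLeft]
  have e1 : d ^ (p - 1) * g ^ (p * (p ^ e - 1)) * d = (g ^ (p ^ e - 1) * d) ^ p ^ 1 * 1 := by
    rw [pow_one, mul_one, mul_pow, ← pow_mul, mul_comm p]
    have : d ^ p = d ^ (p - 1) * d := by rw [← pow_succ, Nat.sub_add_cancel (by omega)]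
    rw [this]; ring
  rw [e1, h₁, hg, ← hφ]
  congr 1
  have : g ^ p ^ e = g ^ (p ^ e - 1) * g := by
    rw [← pow_succ, Nat.sub_add_cancel (Nat.one_le_pow _ _ (by omega))]
  rw [this]; ring

theorem valIdeal_shift' {g : S} {φ₁ : S →+ S} (h₁ : IsPLin p 1 φ₁) (hg : φ₁ 1 = g) (hp : 2 ≤ p)
    {e : ℕ} {d y : S} (h : y ∈ valIdeal p e d) (k : ℕ) : g ^ k * y ∈ valIdeal p (e + k) d := by
  induction k with
  | zero => simpa using h
  | succ k ih =>
    rw [pow_succ', mul_assoc]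
    exact valIdeal_shift h₁ hg hp ih

/-- The key: `c^(3p)` is a uniform multiplier. -/
theorem DualBasis.key [IsNoetherianRing S] [ExpChar S p] (hp : 2 ≤ p) {c : S}
    (hc : DualBasis p c) {d : S} (hd : d ∈ Rcirc S) (e₀ : ℕ) :
    ∃ e : ℕ, e₀ ≤ e ∧ (c ^ p) ^ 3 ∈ valIdeal p e d := by
  obtain ⟨φ₁, h₁, hg⟩ := hc.exists_split hp
  set g := c ^ p with hgdef
  let I : Ideal S :=
    { carrier := {y | ∃ N e : ℕ, g ^ N * y ∈ valIdeal p e d}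
      zero_mem' := ⟨0, 0, by simp⟩
      add_mem' := by
        rintro x y ⟨N, e, hx⟩ ⟨N', e', hy⟩
        refine ⟨N + N' + e + e', e + e', ?_⟩
        have hx' := Ideal.mul_mem_left _ (g ^ (N' + e)) (valIdeal_shift' h₁ hg hp hx e')
        have hy' := Ideal.mul_mem_left _ (g ^ (N + e')) (valIdeal_shift' h₁ hg hp hy e)
        rw [add_comm e' e] at hy'
        have := Ideal.add_mem _ hx' hy'
        convert this using 1
        ring
      smul_mem' := by
        rintro r x ⟨N, e, hx⟩
        refine ⟨N, e, ?_⟩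
        rw [smul_eq_mul, mul_left_comm]
        exact Ideal.mul_mem_left _ _ hx }
  have hI : ∀ e, valIdeal p e d ≤ I := fun e y hy => ⟨0, e, by simpa using hy⟩
  have hmem : ∀ e, c ^ (2 * p ^ e - 2) * d ∈ I ^ (p ^ e) := fun e =>
    frobPow_le_pow _ _ (frobPow_mono (hI e) _ (hc.mem_frobPow hp e d))
  have hrad : c ∈ I.radical := by
    rw [Ideal.radical_eq_sInf]
    rw [Submodule.mem_sInf]
    intro (P : Ideal S) hPP
    obtain ⟨hIP, hP⟩ : I ≤ P ∧ P.IsPrime := hPP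
    by_contra hcP
    let A := Localization.AtPrime P
    have hz : algebraMap S A d = 0 := by
      have h0 : algebraMap S A d ∈ (⨅ i : ℕ, (IsLocalRing.maximalIdeal A) ^ i) := by
        rw [Submodule.mem_iInf]
        intro i
        have hle : i ≤ p ^ i := (Nat.lt_pow_self (by omega)).le
        refine Ideal.pow_le_pow_right hle ?_
        have h2 := Ideal.pow_right_mono hIP _ (hmem i)
        have h3 := Ideal.mem_map_of_mem (algebraMap S A) h2
        rw [Ideal.map_pow, Localization.AtPrime.map_eq_maximalIdeal, map_mul, map_pow] at h3
        have hu : IsUnit (algebraMap S A c) :=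
          IsLocalization.map_units A (⟨c, hcP⟩ : P.primeCompl)
        exact ((Ideal.unit_mul_mem_iff_mem _ (hu.pow _)).mp h3)
      rw [Ideal.iInf_pow_eq_bot_of_isLocalRing _ (Ideal.IsPrime.ne_top')] at h0
      simpa using h0
    obtain ⟨s, hs⟩ := (IsLocalization.map_eq_zero_iff P.primeCompl A d).mp hz
    obtain ⟨Q, hQ, hQP⟩ := Ideal.exists_minimalPrimes_le (bot_le : (⊥ : Ideal S) ≤ P)
    have hQprime : Q.IsPrime := hQ.1.1
    have : (s : S) * d ∈ Q := by rw [hs]; exact Q.zero_mem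
    rcases hQprime.mem_or_mem this with h | h
    · exact s.2 (hQP h)
    · exact hd Q hQ h
  obtain ⟨n, N, e, hn⟩ := hrad
  have h6 : g ^ (3 + (N + n)) ∈ valIdeal p e d := by
    have e1 : g ^ (3 + (N + n)) = (g ^ 3 * c ^ ((p - 1) * n)) * (g ^ N * c ^ n) := by
      obtain ⟨k, hk⟩ : ∃ k, p = k + 1 := ⟨p - 1, by omega⟩
      rw [hgdef, hk]
      simp only [Nat.add_sub_cancel]
      ring
    rw [e1]
    exact Ideal.mul_mem_left _ _ hn
  exact pow_three_mem hp h₁ hg _ e h6 e₀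

theorem Rcirc_pow {c : S} (hc : c ∈ Rcirc S) (n : ℕ) : c ^ n ∈ Rcirc S := by
  intro P hP h
  have : P.IsPrime := hP.1.1
  exact hc P hP (this.mem_of_pow_mem _ h)

end core

/-! ### Duality -/

theorem tmul_eq_zero_of_dual {S : Type u} [CommRing S] [IsNoetherianRing S]
    (F : Type u) [AddCommGroup F] [Module S F] [Module.Finite S F]
    (E : Type u) [AddCommGroup E] [Module S E] (hE : Module.Injective S E)
    (f : F) (z : E) (h : ∀ φ : F →ₗ[S] S, φ f • z = 0) : f ⊗ₜ[S] z = 0 := by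
  classical
  obtain ⟨n, π, hπ⟩ := Module.Finite.exists_fin' S F
  obtain ⟨m, A₀, hA₀⟩ := Module.Finite.exists_fin' S (LinearMap.ker π)
  obtain ⟨f₀, rfl⟩ := hπ f
  let A : (Fin m → S) →ₗ[S] (Fin n → S) := (LinearMap.ker π).subtype ∘ₗ A₀
  let a : Fin n → Fin m → S := fun i j => A (Pi.single j 1) i
  -- `v ↦ v ⬝ w`
  let dot : (Fin n → S) → ((Fin n → S) →ₗ[S] S) := fun v => Fintype.linearCombination S v
  have hdot : ∀ v w, dot v w = ∑ i, w i * v i := by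
    intro v w; simp [dot, Fintype.linearCombination_apply]
  let B : (Fin n → S) →ₗ[S] (Fin m → S) := LinearMap.pi fun j => dot (fun i => a i j)
  let G : (Fin n → S) →ₗ[S] E := (LinearMap.toSpanSingleton S E z) ∘ₗ (dot f₀)
  have hker : LinearMap.ker B ≤ LinearMap.ker G := by
    intro v hv
    have hv' : ∀ j, ∑ i, v i * a i j = 0 := by
      intro j
      have := congrFun (LinearMap.mem_ker.mp hv) j
      simpa [B, hdot] using this
    have hcomp : dot v ∘ₗ A = 0 := by
      refine LinearMap.pi_ext' fun j => LinearMap.ext_ring ?_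
      simp only [LinearMap.comp_apply, LinearMap.coe_single, LinearMap.zero_apply, hdot]
      rw [← hv' j]
      exact Finset.sum_congr rfl fun i _ => mul_comm _ _
    have hk : LinearMap.ker π ≤ LinearMap.ker (dot v) := by
      intro w hw
      obtain ⟨y, hy⟩ := hA₀ ⟨w, hw⟩
      have : A y = w := by simp [A, hy]
      rw [LinearMap.mem_ker, ← this]
      exact LinearMap.congr_fun hcomp y
    let φ : F →ₗ[S] S := (LinearMap.ker π).liftQ (dot v) hk ∘ₗ
      (π.quotKerEquivOfSurjective hπ).symm.toLinearMap
    have hφ : φ (π f₀) = dot v f₀ := by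
      have : (π.quotKerEquivOfSurjective hπ).symm (π f₀) = Submodule.Quotient.mk f₀ := by
        rw [LinearEquiv.symm_apply_eq]; rfl
      simp only [φ, LinearMap.comp_apply, LinearEquiv.coe_coe, this]
      rfl
    have h1 := h φ
    rw [hφ, hdot] at h1
    rw [LinearMap.mem_ker]
    simp only [G, LinearMap.comp_apply, LinearMap.toSpanSingleton_apply, hdot]
    rw [← h1]
    congr 1
    exact Finset.sum_congr rfl fun i _ => mul_comm _ _
  obtain ⟨k, hk⟩ := hE.out ((LinearMap.ker B).liftQ B le_rfl)
    (LinearMap.ker_eq_bot.mp (Submodule.ker_liftQ_eq_bot _ _ _ le_rfl))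
    ((LinearMap.ker B).liftQ G hker)
  have hk' : ∀ v, k (B v) = G v := fun v => hk (Submodule.Quotient.mk v)
  have hvan : TensorProduct.VanishesTrivially S (fun i => π (Pi.single i 1))
      (fun i => f₀ i • z) := by
    refine ⟨m, a, fun j => k (Pi.single j 1), ?_, ?_⟩
    · intro i
      have h1 := hk' (Pi.single i 1)
      have h2 : G (Pi.single i 1) = f₀ i • z := by
        simp [G, hdot, Pi.single_apply]
      have h3 : B (Pi.single i 1) = ∑ j, a i j • (Pi.single j 1 : Fin m → S) := by
        ext j
        simp [B, hdot, Pi.single_apply]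
      rw [h2, h3, map_sum] at h1
      simp only [map_smul] at h1
      exact h1.symm
    · intro j
      have h1 : ∑ i, a i j • (Pi.single i 1 : Fin n → S) = A (Pi.single j 1) := by
        ext i
        simp [a, Pi.single_apply]
      have h2 : π (A (Pi.single j 1)) = 0 := (A₀ (Pi.single j 1)).2
      rw [← h1, map_sum] at h2
      simpa only [map_smul] using h2
  have h1 := TensorProduct.sum_tmul_eq_zero_of_vanishesTrivially S hvan
  simp only [← TensorProduct.smul_tmul, ← TensorProduct.sum_tmul, ← map_smul, ← map_sum] at h1
  have h2 : ∑ i, f₀ i • (Pi.single i 1 : Fin n → S) = f₀ := by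
    ext i
    simp [Pi.single_apply]
  rwa [h2] at h1

section dual
variable {S : Type u} [CommRing S] {p : ℕ} [ExpChar S p]

/-- A `p^{-e}`-linear map as a linear map on `FrobAlg`. -/
noncomputable def IsPLin.toLin {e : ℕ} {φ : S →+ S} (hφ : IsPLin p e φ) : FrobAlg S p e →ₗ[S] S where
  toFun := fun x => φ x
  map_add' := fun x y => φ.map_add x y
  map_smul' := fun r x => hφ r x

theorem IsPLin.toLin_of {e : ℕ} {φ : S →+ S} (hφ : IsPLin p e φ) (x : S) :
    hφ.toLin (FrobAlg.of S p e x) = φ x := rfl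

theorem isPLin_of_lin {e : ℕ} (φ : FrobAlg S p e →ₗ[S] S) :
    IsPLin p e (φ.toAddMonoidHom.comp (FrobAlg.of S p e).toAddMonoidHom) := by
  intro r x
  exact φ.map_smul r (FrobAlg.of S p e x)

/-- Vanishing in `F^e(E)` is detected by `p^{-e}`-linear maps. -/
def Detects (S : Type u) [CommRing S] (p : ℕ) [ExpChar S p] (E : Type u) [AddCommGroup E] [Module S E] : Prop :=
  ∀ (e : ℕ) (f : S) (z : E), (∀ φ : S →+ S, IsPLin p e φ → φ f • z = 0) →
    (FrobAlg.of S p e f) ⊗ₜ[S] z = (0 : TensorProduct S (FrobAlg S p e) E)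

theorem detects_of_injective [IsNoetherianRing S]
    (hfin : ∀ e, Module.Finite S (FrobAlg S p e))
    (E : Type u) [AddCommGroup E] [Module S E] (hE : Module.Injective S E) : Detects S p E := by
  intro e f z h
  have := hfin e
  exact tmul_eq_zero_of_dual (FrobAlg S p e) E hE _ z fun φ => h _ (isPLin_of_lin φ)

theorem detects_of_directSum {ι : Type u} (H : ι → Type u) [∀ m, AddCommGroup (H m)]
    [∀ m, Module S (H m)] (hH : ∀ m, Detects S p (H m))
    (E : Type u) [AddCommGroup E] [Module S E] (eq : E ≃ₗ[S] DirectSum ι H) : Detects S p E := by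
  classical
  intro e f z h
  have hz : z = eq.symm (∑ i ∈ DFinsupp.support (eq z), DirectSum.lof S ι H i (eq z i)) := by
    rw [LinearEquiv.eq_symm_apply]
    exact (DirectSum.sum_support_of (eq z)).symm
  rw [hz, map_sum, TensorProduct.tmul_sum]
  refine Finset.sum_eq_zero fun i _ => ?_
  have h1 : (FrobAlg.of S p e f) ⊗ₜ[S] (eq z i) = (0 : TensorProduct S (FrobAlg S p e) (H i)) := by
    apply hH i
    intro φ hφ
    have h2 := h φ hφ
    have h3 : eq (φ f • z) i = 0 := by rw [h2]; simp
    rw [map_smul] at h3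
    exact h3
  have h4 := congrArg (LinearMap.lTensor (FrobAlg S p e)
    (eq.symm.toLinearMap ∘ₗ DirectSum.lof S ι H i)) h1
  rw [map_zero, LinearMap.lTensor_tmul] at h4
  exact h4

theorem smul_eq_zero_of_tmul {E : Type u} [AddCommGroup E] [Module S E] {e : ℕ} {f : S} {z : E}
    (h : (FrobAlg.of S p e f) ⊗ₜ[S] z = (0 : TensorProduct S (FrobAlg S p e) E))
    {φ : S →+ S} (hφ : IsPLin p e φ) : φ f • z = 0 := by
  have h1 := congrArg ((TensorProduct.lid S E).toLinearMap ∘ₗ LinearMap.rTensor E hφ.toLin) h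
  simpa [IsPLin.toLin_of] using h1

/-- `E` cogenerates cyclic modules. -/
def Cogen (S : Type u) [CommRing S] (E : Type u) [AddCommGroup E] [Module S E] : Prop :=
  ∀ (J : Ideal S) (r : S), r ∉ J → ∃ z : E, (∀ j ∈ J, j • z = 0) ∧ r • z ≠ 0

theorem cogen_aux {S : Type u} [CommRing S] (m : Ideal S) (hm : m ≠ ⊤) (E : Type u)
    [AddCommGroup E] [Module S E]
    (hE : IsInjectiveHull S (S ⧸ m) E) (J : Ideal S) (r : S)
    (hJ : ∀ s, s * r ∈ J → s ∈ m) : ∃ z : E, (∀ j ∈ J, j • z = 0) ∧ r • z ≠ 0 := by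
  obtain ⟨hinj, ι, hι, -⟩ := hE
  let μ : S →ₗ[S] S ⧸ J := LinearMap.toSpanSingleton S (S ⧸ J) (Ideal.Quotient.mk J r)
  have hμ : ∀ s, μ s = Ideal.Quotient.mk J (s * r) := fun s => by
    simp only [μ, LinearMap.toSpanSingleton_apply, map_mul]; rfl
  have hk : LinearMap.ker μ ≤ LinearMap.ker (ι ∘ₗ m.mkQ) := by
    intro s hs
    rw [LinearMap.mem_ker, hμ, Ideal.Quotient.eq_zero_iff_mem] at hs
    have := hJ s hs
    have h0 : m.mkQ s = 0 := (Submodule.Quotient.mk_eq_zero m).mpr this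
    rw [LinearMap.mem_ker, LinearMap.comp_apply, h0, map_zero]
  obtain ⟨k, hk'⟩ := hinj.out ((LinearMap.ker μ).liftQ μ le_rfl)
    (LinearMap.ker_eq_bot.mp (Submodule.ker_liftQ_eq_bot _ _ _ le_rfl))
    ((LinearMap.ker μ).liftQ (ι ∘ₗ m.mkQ) hk)
  have h1 : k (μ 1) = ι (m.mkQ 1) := hk' (Submodule.Quotient.mk 1)
  have h2 : ∀ s, k (Ideal.Quotient.mk J s) = s • k (Ideal.Quotient.mk J 1) := by
    intro s
    rw [← map_smul]
    congr 1
    rw [← mul_one s, map_mul, mul_one]; rfl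
  refine ⟨k (Ideal.Quotient.mk J 1), ?_, ?_⟩
  · intro j hj
    rw [← h2, Ideal.Quotient.eq_zero_iff_mem.mpr hj, map_zero]
  · rw [← h2]
    rw [hμ, one_mul] at h1
    rw [h1]
    intro h0
    have := hι (h0.trans (map_zero ι).symm)
    have h3 := (Submodule.Quotient.mk_eq_zero m).mp this
    exact hm ((Ideal.eq_top_iff_one m).mpr h3)

/-- The explicit description of the test ideal. -/
def traceTau (p : ℕ) (a : Ideal S) (t : ℚ) (g : S) : Ideal S :=
  Ideal.span {y | ∃ (e : ℕ) (φ : S →+ S), IsPLin p e φ ∧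
    ∃ x ∈ a ^ ⌈t * (p : ℚ) ^ e⌉₊, φ (g * x) = y}

theorem tildeTau_eq [IsNoetherianRing S] (hp : 2 ≤ p) {c : S} (hc : DualBasis p c)
    (hcR : c ∈ Rcirc S) (a : Ideal S) (t : ℚ) (E : Type u) [AddCommGroup E] [Module S E]
    (hdet : Detects S p E) (hcog : Cogen S E) :
    tildeTau S p a t E = traceTau p a t ((c ^ p) ^ 3) := by
  apply le_antisymm
  · intro r hr
    by_contra hrT
    obtain ⟨z, hz, hrz⟩ := hcog _ r hrT
    apply hrz
    rw [tildeTau, Submodule.mem_annihilator] at hr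
    apply hr z
    refine Submodule.subset_span ⟨(c ^ p) ^ 3, Rcirc_pow (Rcirc_pow hcR _) _, 0, ?_⟩
    intro e _ x hx
    apply hdet
    intro φ hφ
    exact hz _ (Ideal.subset_span ⟨e, φ, hφ, x, hx, rfl⟩)
  · refine Ideal.span_le.mpr ?_
    rintro _ ⟨e, φ, hφ, x, hx, rfl⟩
    simp only [SetLike.mem_coe]
    rw [tildeTau, Submodule.mem_annihilator_span]
    rintro ⟨z, d, hd, e₀, hz⟩
    obtain ⟨e', he', ψ, hψ, hψd⟩ := hc.key hp hd e₀
    have hx' : x ^ p ^ e' ∈ a ^ ⌈t * (p : ℚ) ^ (e + e')⌉₊ := by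
      refine Ideal.pow_le_pow_right (n := ⌈t * (p : ℚ) ^ e⌉₊ * p ^ e') ?_ ?_
      · rw [Nat.ceil_le]
        push_cast
        rw [pow_add, ← mul_assoc]
        exact mul_le_mul_of_nonneg_right (Nat.le_ceil _) (by positivity)
      · rw [pow_mul]
        exact Ideal.pow_mem_pow hx _
    have h1 := smul_eq_zero_of_tmul (hz (e + e') (by omega) _ hx') (hφ.comp hψ)
    rw [AddMonoidHom.comp_apply, mul_comm d, hψ, hψd, mul_comm x] at h1
    exact h1

end dual

/-! ### Generic freeness -/

theorem isField_of_minimal {S : Type u} [CommRing S] [IsReduced S] (P : Ideal S) [P.IsPrime]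
    (hP : P ∈ minimalPrimes S) : IsField (Localization.AtPrime P) := by
  have hsub := IsLocalization.subsingleton_primeSpectrum_of_mem_minimalPrimes P hP
    (Localization.AtPrime P)
  rw [IsLocalRing.isField_iff_maximalIdeal_eq]
  have hred : IsReduced (Localization.AtPrime P) :=
    isReduced_localizationPreserves P.primeCompl (Localization.AtPrime P) inferInstance
  rw [eq_bot_iff]
  intro x hx
  suffices hn : x ∈ nilradical (Localization.AtPrime P) by
    rwa [nilradical_eq_zero] at hn
  rw [nilradical_eq_sInf, Submodule.mem_sInf]
  intro (Q : Ideal _) hQ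
  have h1 : (⟨Q, hQ⟩ : PrimeSpectrum (Localization.AtPrime P)) =
    ⟨IsLocalRing.maximalIdeal _, inferInstance⟩ := Subsingleton.elim _ _
  have h2 : Q = IsLocalRing.maximalIdeal _ := congrArg PrimeSpectrum.asIdeal h1
  rw [h2]
  exact hx

theorem exists_factor {S : Type u} [CommRing S] [IsNoetherianRing S] [IsReduced S]
    (M : Type u) [AddCommGroup M] [Module S M] [Module.Finite S M] :
    ∃ c ∈ Rcirc S, ∃ (n : ℕ) (h : M →ₗ[S] (Fin n → S)) (π : (Fin n → S) →ₗ[S] M),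
      ∀ x, π (h x) = c • x := by
  obtain ⟨n, π, hπ⟩ := Module.Finite.exists_fin' S M
  let D : Ideal S :=
    { carrier := {c | ∃ h : M →ₗ[S] (Fin n → S), ∀ x, π (h x) = c • x}
      zero_mem' := ⟨0, by simp⟩
      add_mem' := by
        rintro c d ⟨h, hh⟩ ⟨k, hk⟩
        exact ⟨h + k, fun x => by simp [hh, hk, add_smul]⟩
      smul_mem' := by
        rintro r c ⟨h, hh⟩
        exact ⟨r • h, fun x => by simp [hh, mul_smul]⟩ }
  have hD : ∀ P ∈ minimalPrimes S, ¬ D ≤ P := by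
    intro P hP hle
    have hPp : P.IsPrime := hP.1.1
    let _ : Field (Localization.AtPrime P) := (isField_of_minimal P hP).toField
    obtain ⟨σ, hσ⟩ := (LocalizedModule.map P.primeCompl π).exists_rightInverse_of_surjective
      (LinearMap.range_eq_top.mpr (LocalizedModule.map_surjective P.primeCompl π hπ))
    have : Module.FinitePresentation S M := Module.finitePresentation_of_finite S M
    obtain ⟨h, s, hs⟩ := Module.FinitePresentation.exists_lift_of_isLocalizedModule P.primeCompl
      (LocalizedModule.mkLinearMap P.primeCompl (Fin n → S))
      ((σ.restrictScalars S) ∘ₗ LocalizedModule.mkLinearMap P.primeCompl M)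
    have h1 : (LocalizedModule.mkLinearMap P.primeCompl M) ∘ₗ (π ∘ₗ h) =
        (LocalizedModule.mkLinearMap P.primeCompl M) ∘ₗ ((s : S) • LinearMap.id) := by
      ext x
      have h2 := LinearMap.congr_fun hs x
      have h3 := congrArg (LocalizedModule.map P.primeCompl π) h2
      have h4 := LinearMap.congr_fun hσ (LocalizedModule.mkLinearMap P.primeCompl M x)
      simp only [LinearMap.comp_apply, LinearMap.smul_apply, LinearMap.id_apply] at h3 h4 ⊢
      have h5 : (s • (σ.restrictScalars S) (LocalizedModule.mkLinearMap P.primeCompl M x)) =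
        algebraMap S (Localization.AtPrime P) (s : S) •
          σ (LocalizedModule.mkLinearMap P.primeCompl M x) := by
        rw [algebraMap_smul]; rfl
      rw [h5, map_smul, h4, algebraMap_smul] at h3
      rw [map_smul, ← h3]
      simp [LocalizedModule.map_mk]
    obtain ⟨u, hu⟩ := Module.Finite.exists_smul_of_comp_eq_of_isLocalizedModule P.primeCompl
      (LocalizedModule.mkLinearMap P.primeCompl M) _ _ h1
    have hmem : (u : S) * s ∈ D := by
      refine ⟨(u : S) • h, fun x => ?_⟩
      have := LinearMap.congr_fun hu x
      rw [LinearMap.smul_apply, map_smul, mul_smul]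
      exact this
    exact (u * s).2 (hle hmem)
  have : ∃ c ∈ D, c ∈ Rcirc S := by
    by_contra! hcon
    have hfin := minimalPrimes.finite_of_isNoetherianRing S
    obtain ⟨P, hP, hle⟩ := (Ideal.subset_union_prime (s := hfin.toFinset) (f := id) (I := D) 0 0
      (fun P hP _ _ => ((hfin.mem_toFinset).mp hP).1.1)).mp (by
        intro c hc
        have := hcon c hc
        simp only [Rcirc, Set.mem_ofPred_eq, not_forall, not_not] at this
        obtain ⟨P, hP, hcP⟩ := this
        simp only [Set.mem_iUnion]
        exact ⟨P, by simpa using hP, hcP⟩)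
    exact hD P ((hfin.mem_toFinset).mp hP) hle
  obtain ⟨c, ⟨h, hh⟩, hc⟩ := this
  exact ⟨c, hc, n, h, π, hh⟩

theorem exists_dualBasis {S : Type u} [CommRing S] {p : ℕ} [ExpChar S p] [IsNoetherianRing S]
    [IsReduced S] (hfin : Module.Finite S (FrobAlg S p 1)) :
    ∃ c ∈ Rcirc S, DualBasis p c := by
  classical
  obtain ⟨c, hc, n, h, π, hh⟩ := exists_factor (S := S) (FrobAlg S p 1)
  refine ⟨c, hc, n, fun i => ((LinearMap.proj i ∘ₗ h : FrobAlg S p 1 →ₗ[S] S)).toAddMonoidHom.comp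
    (FrobAlg.of S p 1).toAddMonoidHom, fun i => (π (Pi.single i 1) : S),
    fun i => isPLin_of_lin _, fun f => ?_⟩
  have h1 := hh (FrobAlg.of S p 1 f)
  have h2 : π (h (FrobAlg.of S p 1 f)) =
      ∑ i, h (FrobAlg.of S p 1 f) i • π (Pi.single i 1) := by
    conv_lhs => rw [← Finset.univ_sum_single (h (FrobAlg.of S p 1 f)), map_sum]
    refine Finset.sum_congr rfl fun i _ => ?_
    rw [← map_smul]
    congr 1
    ext j
    simp [Pi.single_apply]
  have h3 : ∀ (r : S) (x : FrobAlg S p 1), r • x = FrobAlg.of S p 1 (r ^ p) * x := by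
    intro r x
    have : r • x = FrobAlg.of S p 1 (r ^ p ^ 1) * x := rfl
    rwa [pow_one] at this
  rw [h2] at h1
  simp only [h3] at h1
  exact h1.symm

/-! ### Finiteness -/

theorem finite_frobAlg {S : Type u} [CommRing S] {p : ℕ} [ExpChar S p] (h : IsFFinite S p)
    (e : ℕ) : Module.Finite S (FrobAlg S p e) := by
  have h1 : (iterateFrobenius S p 1).Finite := h
  have h2 : ∀ e, (iterateFrobenius S p e).Finite := by
    intro e
    induction e with
    | zero => rw [iterateFrobenius_zero]; exact RingHom.Finite.id S
    | succ e ih =>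
      have : iterateFrobenius S p (e + 1) =
          (iterateFrobenius S p 1).comp (iterateFrobenius S p e) := by
        ext x
        rw [RingHom.comp_apply, iterateFrobenius_def, iterateFrobenius_def, iterateFrobenius_def,
          pow_add, pow_mul]
      rw [this]
      exact h1.comp ih
  exact h2 e

section loc
variable {S : Type u} [CommRing S] {p : ℕ} (W : Submonoid S)

theorem exists_rep (q : ℕ) (hq : 1 ≤ q) (y : (Localization W)) :
    ∃ (x : S) (w : W), y = (IsLocalization.mk' (Localization W) 1 w) ^ q * algebraMap S (Localization W) x := by
  obtain ⟨x, w, rfl⟩ := IsLocalization.exists_mk'_eq W y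
  refine ⟨x * (w : S) ^ (q - 1), w, ?_⟩
  have hw : IsLocalization.mk' (Localization W) 1 w * algebraMap S (Localization W) w = 1 := by
    rw [IsLocalization.mk'_spec, map_one]
  have hx : IsLocalization.mk' (Localization W) x w = algebraMap S (Localization W) x * IsLocalization.mk' (Localization W) 1 w := by
    rw [IsLocalization.mul_mk'_eq_mk'_of_mul, mul_one]
  obtain ⟨k, rfl⟩ := Nat.exists_eq_add_of_le hq
  rw [hx, map_mul, map_pow, Nat.add_sub_cancel_left, pow_add, pow_one]
  have : IsLocalization.mk' (Localization W) (1 : S) w ^ k * algebraMap S (Localization W) (w : S) ^ k = 1 := by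
    rw [← mul_pow, hw, one_pow]
  linear_combination (-(algebraMap S (Localization W) x * IsLocalization.mk' (Localization W) 1 w)) * this

theorem finite_frobAlg_loc [ExpChar S p] [ExpChar (Localization W) p] (hp : 1 ≤ p) (e : ℕ)
    (h : Module.Finite S (FrobAlg S p e)) : Module.Finite (Localization W) (FrobAlg (Localization W) p e) := by
  classical
  obtain ⟨s, hs⟩ := h.fg_top
  let α : S → FrobAlg (Localization W) p e := fun x => FrobAlg.of (Localization W) p e (algebraMap S (Localization W) x)
  let β : FrobAlg S p e → FrobAlg (Localization W) p e := fun x => α x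
  refine ⟨⟨s.image β, ?_⟩⟩
  rw [eq_top_iff]
  intro y _
  obtain ⟨x, w, hy⟩ := exists_rep W (p ^ e) (Nat.one_le_pow _ _ hp) (y : (Localization W))
  have hy' : y = (IsLocalization.mk' (Localization W) 1 w) • α x := hy
  rw [hy']
  refine Submodule.smul_mem _ _ ?_
  have hx : FrobAlg.of S p e x ∈ Submodule.span S (s : Set (FrobAlg S p e)) := by
    rw [hs]; trivial
  have : ∀ z ∈ Submodule.span S (s : Set (FrobAlg S p e)),
      β z ∈ Submodule.span (Localization W) ((s.image β : Finset _) : Set (FrobAlg (Localization W) p e)) := by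
    intro z hz
    induction hz using Submodule.span_induction with
    | mem z hz => exact Submodule.subset_span (by simpa using ⟨z, hz, rfl⟩)
    | zero =>
      have : β 0 = 0 := map_zero (algebraMap S (Localization W))
      rw [this]; exact Submodule.zero_mem _
    | add a b _ _ iha ihb =>
      have : β (a + b) = β a + β b := map_add (algebraMap S (Localization W)) _ _
      rw [this]; exact Submodule.add_mem _ iha ihb
    | smul r a _ iha =>
      have : β (r • a) = (algebraMap S (Localization W) r) • β a := by
        have h1 : ∀ a' : S, algebraMap S (Localization W) (r ^ p ^ e * a') =
          (algebraMap S (Localization W) r) ^ p ^ e * algebraMap S (Localization W) a' := fun a' => by rw [map_mul, map_pow]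
        exact h1 a
      rw [this]; exact Submodule.smul_mem _ _ iha
  exact this _ hx

theorem exists_extend (hp : 1 ≤ p) {e : ℕ} {φ : S →+ S} (hφ : IsPLin p e φ) :
    ∃ ψ : (Localization W) →+ (Localization W), IsPLin p e ψ ∧ ∀ x, ψ (algebraMap S (Localization W) x) = algebraMap S (Localization W) (φ x) := by
  set q := p ^ e with hq
  have hq1 : 1 ≤ q := Nat.one_le_pow _ _ hp
  have hqq : ∀ w : S, w ^ q = w ^ (q - 1) * w := fun w => by
    rw [← pow_succ, Nat.sub_add_cancel hq1]
  have wd : ∀ (x x' : S) (w w' : W), IsLocalization.mk' (Localization W) x w = IsLocalization.mk' (Localization W) x' w' →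
      IsLocalization.mk' (Localization W) (φ (x * (w : S) ^ (q - 1))) w =
      IsLocalization.mk' (Localization W) (φ (x' * (w' : S) ^ (q - 1))) w' := by
    intro x x' w w' h
    obtain ⟨u, hu⟩ := IsLocalization.eq.mp h
    refine IsLocalization.eq.mpr ⟨u, ?_⟩
    rw [← hφ, ← hφ, ← hφ, ← hφ, ← hq]
    congr 1
    rw [hqq u, hqq w, hqq w']
    linear_combination ((u : S) ^ (q - 1) * (w : S) ^ (q - 1) * (w' : S) ^ (q - 1)) * hu
  choose X Y hXY using fun y : (Localization W) => IsLocalization.exists_mk'_eq W y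
  let f : (Localization W) → (Localization W) := fun y => IsLocalization.mk' (Localization W) (φ (X y * (Y y : S) ^ (q - 1))) (Y y)
  have hf : ∀ x w, f (IsLocalization.mk' (Localization W) x w) =
      IsLocalization.mk' (Localization W) (φ (x * (w : S) ^ (q - 1))) w := fun x w =>
    wd _ _ _ _ (hXY _)
  have common : ∀ y z : (Localization W), ∃ (a b : S) (w : W), y = IsLocalization.mk' (Localization W) a w ∧
      z = IsLocalization.mk' (Localization W) b w := by
    intro y z
    obtain ⟨a, w, rfl⟩ := IsLocalization.exists_mk'_eq W y
    obtain ⟨b, v, rfl⟩ := IsLocalization.exists_mk'_eq W z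
    refine ⟨v * a, w * b, w * v, ?_, ?_⟩
    · exact IsLocalization.eq.mpr ⟨1, by simp only [Submonoid.coe_mul]; ring⟩
    · exact IsLocalization.eq.mpr ⟨1, by simp only [Submonoid.coe_mul]; ring⟩
  have hadd : ∀ (a b : S) (w : W), IsLocalization.mk' (Localization W) (a + b) w =
      IsLocalization.mk' (Localization W) a w + IsLocalization.mk' (Localization W) b w := by
    intro a b w
    rw [IsLocalization.mk'_eq_mul_mk'_one (a + b) w, IsLocalization.mk'_eq_mul_mk'_one a w,
      IsLocalization.mk'_eq_mul_mk'_one b w, map_add, add_mul]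
  refine ⟨AddMonoidHom.mk' f ?_, ?_, ?_⟩
  · intro y z
    obtain ⟨a, b, w, rfl, rfl⟩ := common y z
    rw [← hadd, hf, hf, hf, add_mul, map_add, hadd]
  · intro r y
    obtain ⟨a, b, w, rfl, rfl⟩ := common r y
    simp only [AddMonoidHom.mk'_apply]
    rw [← IsLocalization.mk'_pow, ← IsLocalization.mk'_mul, hf, hf, ← IsLocalization.mk'_mul]
    refine IsLocalization.eq.mpr ⟨1, ?_⟩
    simp only [OneMemClass.coe_one, one_mul, Submonoid.coe_mul, SubmonoidClass.coe_pow]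
    rw [← hφ a, ← hφ, ← hφ, ← hq]
    congr 1
    rw [hqq ((w : S) * w), hqq ((w : S) ^ q * w)]
    linear_combination (-((w : S) * (w : S) ^ ((q - 1) * 2) * (w : S) ^ ((q - 1) * q) * a ^ q * b)) *
      hqq (w : S)
  · intro x
    simp only [AddMonoidHom.mk'_apply]
    have := hf x 1
    rw [OneMemClass.coe_one, one_pow, mul_one, IsLocalization.mk'_one,
      IsLocalization.mk'_one] at this
    exact this

theorem DualBasis.loc (hp : 1 ≤ p) {c : S} (hc : DualBasis p c) :
    DualBasis p (algebraMap S (Localization W) c) := by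
  obtain ⟨n, φ, b, hφ, hb⟩ := hc
  choose ψ hψ hψφ using fun i => exists_extend W hp (hφ i)
  refine ⟨n, ψ, fun i => algebraMap S (Localization W) (b i), hψ, fun y => ?_⟩
  obtain ⟨x, w, rfl⟩ := exists_rep W (p ^ 1) (by simpa using hp) y
  have h1 := congrArg (algebraMap S (Localization W)) (hb x)
  simp only [map_mul, map_pow, map_sum] at h1
  rw [mul_left_comm, h1, Finset.mul_sum]
  refine Finset.sum_congr rfl fun i _ => ?_
  rw [hψ i, hψφ, pow_one]
  ring

theorem Rcirc_loc {c : S} (hc : c ∈ Rcirc S) : algebraMap S (Localization W) c ∈ Rcirc (Localization W) := by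
  intro P hP h
  have h1 : P ∈ ((⊥ : Ideal S).map (algebraMap S (Localization W))).minimalPrimes := by
    rw [Ideal.map_bot]; exact hP
  rw [IsLocalization.minimalPrimes_map W (Localization W)] at h1
  exact hc _ h1 h

theorem exists_descend [ExpChar S p] [IsNoetherianRing S] {e : ℕ}
    (hfin : Module.Finite S (FrobAlg S p e)) {ψ : (Localization W) →+ (Localization W)} (hψ : IsPLin p e ψ) :
    ∃ (w : W) (φ : S →+ S), IsPLin p e φ ∧
      ∀ x, algebraMap S (Localization W) (φ x) = algebraMap S (Localization W) w * ψ (algebraMap S (Localization W) x) := by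
  have : Module.FinitePresentation S (FrobAlg S p e) := Module.finitePresentation_of_finite _ _
  let α : FrobAlg S p e →+* (Localization W) := algebraMap S (Localization W)
  let g : FrobAlg S p e →ₗ[S] (Localization W) :=
    { toFun := fun x => ψ (α x)
      map_add' := fun x y => by rw [map_add, map_add]
      map_smul' := fun r x => by
        have h1 : α (r • x) = (algebraMap S (Localization W) r) ^ p ^ e * α x := by
          have : ∀ a' : S, algebraMap S (Localization W) (r ^ p ^ e * a') =
            (algebraMap S (Localization W) r) ^ p ^ e * algebraMap S (Localization W) a' := fun a' => by rw [map_mul, map_pow]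
          exact this x
        rw [h1, hψ, RingHom.id_apply, Algebra.smul_def] }
  obtain ⟨h, s, hs⟩ := Module.FinitePresentation.exists_lift_of_isLocalizedModule W
    (Algebra.linearMap S (Localization W)) g
  refine ⟨s, _, isPLin_of_lin h, fun x => ?_⟩
  have h1 := LinearMap.congr_fun hs (FrobAlg.of S p e x)
  have h2 : (s • g) (FrobAlg.of S p e x) = algebraMap S (Localization W) s * ψ (algebraMap S (Localization W) x) := by
    rw [← Algebra.smul_def]; rfl
  rw [← h2, ← h1]
  rfl

theorem traceTau_loc [ExpChar S p] [IsNoetherianRing S] (hp : 1 ≤ p)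
    (hfin : ∀ e, Module.Finite S (FrobAlg S p e)) (a : Ideal S) (t : ℚ) (g : S) :
    traceTau p (a.map (algebraMap S (Localization W))) t (algebraMap S (Localization W) g) =
      (traceTau p a t g).map (algebraMap S (Localization W)) := by
  apply le_antisymm
  · refine Ideal.span_le.mpr ?_
    rintro _ ⟨e, ψ, hψ, x, hx, rfl⟩
    rw [← Ideal.map_pow, IsLocalization.mem_map_algebraMap_iff W (Localization W)] at hx
    obtain ⟨⟨⟨x₀, hx₀⟩, s⟩, hxs⟩ := hx
    simp only at hxs
    obtain ⟨w, φ, hφ, hφψ⟩ := exists_descend W (hfin e) hψ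
    have hq : (algebraMap S (Localization W) s) ^ p ^ e = (algebraMap S (Localization W) s) ^ (p ^ e - 1) * algebraMap S (Localization W) s := by
      rw [← pow_succ, Nat.sub_add_cancel (Nat.one_le_pow _ _ hp)]
    have h1 : algebraMap S (Localization W) (φ (g * (x₀ * (s : S) ^ (p ^ e - 1)))) =
        algebraMap S (Localization W) (w * s : W) * ψ (algebraMap S (Localization W) g * x) := by
      rw [hφψ, Submonoid.coe_mul, map_mul _ (w : S), mul_assoc, ← hψ (algebraMap S (Localization W) s), hq]
      congr 2
      simp only [map_mul, map_pow, ← hxs]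
      ring
    have hu : IsUnit (algebraMap S (Localization W) (w * s : W)) := IsLocalization.map_units (Localization W) (w * s)
    rw [SetLike.mem_coe, ← Ideal.unit_mul_mem_iff_mem _ hu, ← h1]
    exact Ideal.mem_map_of_mem _ (Ideal.subset_span
      ⟨e, φ, hφ, _, Ideal.mul_mem_right _ _ hx₀, rfl⟩)
  · rw [traceTau, Ideal.map_span]
    refine Ideal.span_le.mpr ?_
    rintro _ ⟨_, ⟨e, φ, hφ, x, hx, rfl⟩, rfl⟩
    obtain ⟨ψ, hψ, hψφ⟩ := exists_extend W hp hφ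
    refine Ideal.subset_span ⟨e, ψ, hψ, algebraMap S (Localization W) x, ?_, ?_⟩
    · rw [← Ideal.map_pow]; exact Ideal.mem_map_of_mem _ hx
    · rw [← map_mul, hψφ]

end loc

open scoped DirectSum

/-- **Proposition 3.1** (Hara–Takagi): localization.  `(R,m)` F-finite reduced (excellent)
local of characteristic `p > 0`, `a ∩ R° ≠ ∅`, `t ≥ 0` rational, `W ⊆ R` multiplicatively
closed; if condition `(*)` holds for `aᵗ` over `R` and for `(a R_W)ᵗ` over `R_W`
(the ideal `τ̃` over `R_W` being computed in `E = ⊕_n E(R_W/n)`, the sum over all maximal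
ideals of `R_W` of injective hulls of the residue fields), then
`τ((a R_W)ᵗ) = τ(aᵗ) R_W`. -/
theorem testIdeal_localization
    (p : ℕ) [Fact p.Prime] [CharP R p] [ExpChar R p]
    [IsNoetherianRing R] [IsReduced R] [IsLocalRing R]
    (hFF : IsFFinite R p)
    (a : Ideal R) (ha : ((a : Set R) ∩ Rcirc R).Nonempty)
    (t : ℚ) (ht : 0 ≤ t)
    (W : Submonoid R)
    (E : Type u) [AddCommGroup E] [Module R E]
    (hE : IsInjectiveHull R (R ⧸ IsLocalRing.maximalIdeal R) E)
    (hstar : testIdeal R p a t = tildeTau R p a t E)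
    [ExpChar (Localization W) p]
    (H : MaximalSpectrum (Localization W) → Type u)
    [∀ m, AddCommGroup (H m)] [∀ m, Module (Localization W) (H m)]
    (hH : ∀ m : MaximalSpectrum (Localization W),
      IsInjectiveHull (Localization W) (Localization W ⧸ m.asIdeal) (H m))
    (E' : Type u) [AddCommGroup E'] [Module (Localization W) E']
    (hE' : Nonempty (E' ≃ₗ[Localization W] ⨁ m : MaximalSpectrum (Localization W), H m))
    (hstar' : testIdeal (Localization W) p (a.map (algebraMap R (Localization W))) t
      = tildeTau (Localization W) p (a.map (algebraMap R (Localization W))) t E') :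
    testIdeal (Localization W) p (a.map (algebraMap R (Localization W))) t
      = (testIdeal R p a t).map (algebraMap R (Localization W)) := by
  classical
  have hp : 2 ≤ p := (Fact.out : p.Prime).two_le
  have hp1 : 1 ≤ p := by omega
  have hfin := finite_frobAlg hFF
  have hfin' : ∀ e, Module.Finite (Localization W) (FrobAlg (Localization W) p e) := fun e =>
    finite_frobAlg_loc W hp1 e (hfin e)
  have hN : IsNoetherianRing (Localization W) :=
    IsLocalization.isNoetherianRing W (Localization W) inferInstance
  obtain ⟨c, hc, hdb⟩ := exists_dualBasis (hfin 1)
  have hcog : Cogen R E := by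
    intro J r hr
    refine cogen_aux _ (Ideal.IsPrime.ne_top') E hE J r fun s hs => ?_
    rw [IsLocalRing.mem_maximalIdeal, mem_nonunits_iff]
    intro hu
    exact hr ((Ideal.unit_mul_mem_iff_mem _ hu).mp hs)
  obtain ⟨eq⟩ := hE'
  have hcog' : Cogen (Localization W) E' := by
    intro J r hr
    let I : Ideal (Localization W) :=
      Submodule.comap (LinearMap.mulRight (Localization W) r) J
    have hI : I ≠ ⊤ := by
      intro h
      have : (1 : Localization W) ∈ I := by rw [h]; trivial
      exact hr (by simpa [I] using this)
    obtain ⟨m, hm, hIm⟩ := Ideal.exists_le_maximal I hI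
    obtain ⟨z, hz, hrz⟩ := cogen_aux m hm.ne_top (H ⟨m, hm⟩) (hH ⟨m, hm⟩) J r
      (fun s hs => hIm hs)
    let ι := eq.symm.toLinearMap ∘ₗ DirectSum.lof (Localization W) _ H ⟨m, hm⟩
    have hι : Function.Injective ι :=
      eq.symm.injective.comp (DirectSum.of_injective (β := H) ⟨m, hm⟩)
    refine ⟨ι z, fun j hj => ?_, fun h => hrz ?_⟩
    · rw [← map_smul, hz j hj, map_zero]
    · rw [← map_smul] at h
      exact hι (h.trans (map_zero ι).symm)
  have hdet : Detects R p E := detects_of_injective hfin E hE.1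
  have hdet' : Detects (Localization W) p E' :=
    detects_of_directSum H (fun m => detects_of_injective hfin' (H m) (hH m).1) E' eq
  rw [hstar', hstar, tildeTau_eq hp hdb hc a t E hdet hcog,
    tildeTau_eq hp (hdb.loc W hp1) (Rcirc_loc W hc) _ t E' hdet' hcog',
    ← traceTau_loc W hp1 hfin, map_pow, map_pow]
end
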